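/- arXiv:1109.5063 — 3 statements merged into one kernel-verified Lean document; each statement's English description precedes it below -/
import Mathlib

section
/- Let p ∈ [1,2), let q ∈ [1,∞), and let X be any normed space. Let k_1, k_2 ∈ ℕ be such that there exist Hadamard matrices of orders k_1 and k_2 and such that: (i) 2 − 2^{p−1} < 1/k_1 + 1/k_2 < 4 − 2^p, (ii) (1 − 2^{−p})(2 − 2^{p−1}) < (1 − 2^{1−p})/k_1 + 1/k_2, and (iii) (1 − 2^{−p})(2 − 2^{p−1}) < 1/k_1 + (1 − 2^{1−p})/k_2. Then m(ℓ_p^d ⊕_q X) ≤ 2(k_1 + k_2) for all integers d ≥ 2(k_1 + k_2 − 1). -/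
/-- A set `A` in a normed space is `lam`-equilateral if `lam > 0` and the distance
between any two distinct points of `A` equals `lam`. -/
def EquilateralWith {E : Type*} [NormedAddCommGroup E] (A : Set E) (lam : ℝ) : Prop :=
  0 < lam ∧ A.Pairwise fun x y => ‖x - y‖ = lam

/-- A set is equilateral if it is `lam`-equilateral for some `lam > 0`. -/
def Equilateral {E : Type*} [NormedAddCommGroup E] (A : Set E) : Prop :=
  ∃ lam : ℝ, EquilateralWith A lam

/-- An equilateral set is maximal if it is not properly contained in any equilateral set. -/
def MaximalEquilateral {E : Type*} [NormedAddCommGroup E] (A : Set E) : Prop :=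
  Equilateral A ∧ ∀ B : Set E, Equilateral B → A ⊆ B → B = A

/-- An `n × n` real matrix is a Hadamard matrix if every entry is `±1` and
`H * Hᵀ = n • 1`. -/
def IsHadamardMatrix {n : ℕ} (H : Matrix (Fin n) (Fin n) ℝ) : Prop :=
  (∀ i j, H i j = 1 ∨ H i j = -1) ∧ H * H.transpose = (n : ℝ) • 1

/-- Normalizing a Hadamard matrix so that its first column is constant and deleting that column
leaves sign vectors whose pairwise inner products are `-1` and whose columns, together with the
constant vector, are linearly independent. -/
lemma IsHadamardMatrix.exists_core {n : ℕ} {H : Matrix (Fin (n + 1)) (Fin (n + 1)) ℝ}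
    (hH : IsHadamardMatrix H) :
    ∃ h : Fin (n + 1) → Fin n → ℝ, (∀ i j, h i j = 1 ∨ h i j = -1) ∧
      (∀ i i', i ≠ i' → ∑ j, h i j * h i' j = -1) ∧
      ∀ (w : Fin n → ℝ) (C : ℝ), (∀ i, ∑ j, h i j * w j = C) → ∀ j, w j = 0 := by
  obtain ⟨hs, hO⟩ := hH
  have hsq : ∀ i j, H i j * H i j = 1 := fun i j => by
    rcases hs i j with h | h <;> rw [h] <;> norm_num
  refine ⟨fun i j => H i 0 * H i j.succ, fun i j => ?_, fun i i' hii => ?_, fun w C hw => ?_⟩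
  · rcases hs i 0 with h | h <;> rcases hs i j.succ with h' | h' <;> simp [h, h']
  · have h0 := congrFun (congrFun hO i) i'
    rw [Matrix.mul_apply, Fin.sum_univ_succ] at h0
    simp only [Matrix.transpose_apply, Matrix.smul_apply, Matrix.one_apply_ne hii, smul_zero] at h0
    have : ∑ j : Fin n, H i 0 * H i j.succ * (H i' 0 * H i' j.succ)
        = H i 0 * H i' 0 * ∑ j : Fin n, H i j.succ * H i' j.succ := by
      rw [Finset.mul_sum]; exact Finset.sum_congr rfl fun j _ => by ring
    rw [this, eq_neg_of_add_eq_zero_right h0]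
    linear_combination -(H i' 0 * H i' 0) * hsq i 0 - hsq i' 0
  · have hn : ((n + 1 : ℕ) : ℝ) ≠ 0 := by positivity
    have hinv : (((n + 1 : ℕ) : ℝ)⁻¹ • H.transpose) * H = 1 := by
      apply mul_eq_one_comm.mp
      rw [Matrix.mul_smul, hO, smul_smul, inv_mul_cancel₀ hn, one_smul]
    have hz : H.mulVec (Fin.cons (-C) w) = 0 := by
      ext i
      have h1 := hw i
      have : ∑ j : Fin n, H i 0 * H i j.succ * w j = H i 0 * ∑ j : Fin n, H i j.succ * w j := by
        rw [Finset.mul_sum]; exact Finset.sum_congr rfl fun j _ => by ring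
      rw [this] at h1
      simp only [Matrix.mulVec, dotProduct, Fin.sum_univ_succ, Fin.cons_zero, Fin.cons_succ,
        Pi.zero_apply]
      linear_combination H i 0 * h1 - (∑ j : Fin n, H i j.succ * w j) * hsq i 0
    have hw0 : (Fin.cons (-C) w : Fin (n + 1) → ℝ) = 0 := by
      rw [← Matrix.one_mulVec (Fin.cons (-C) w : Fin (n + 1) → ℝ), ← hinv, ← Matrix.mulVec_mulVec,
        hz, Matrix.mulVec_zero]
    intro j
    simpa using congrFun hw0 j.succ

lemma abs_add_rpow_sub_abs_sub_rpow_nonneg {p a x : ℝ} (hp : 0 ≤ p) (ha : 0 ≤ a) (hx : 0 ≤ x) :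
    0 ≤ |x + a| ^ p - |x - a| ^ p :=
  sub_nonneg.mpr <| Real.rpow_le_rpow (abs_nonneg _)
    (abs_le_abs (by linarith) (by linarith)) hp

lemma abs_add_rpow_sub_abs_sub_rpow_pos {p a x : ℝ} (hp : 0 < p) (ha : 0 < a) (hx : 0 < x) :
    0 < |x + a| ^ p - |x - a| ^ p := by
  refine sub_pos.mpr <| Real.rpow_lt_rpow (abs_nonneg _) ?_ hp
  rw [abs_of_pos (add_pos hx ha), abs_lt]
  constructor <;> linarith

lemma abs_neg_add_rpow_sub (p a x : ℝ) :
    |-x + a| ^ p - |-x - a| ^ p = -(|x + a| ^ p - |x - a| ^ p) := by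
  rw [show -x + a = -(x - a) by ring, show -x - a = -(x + a) by ring, abs_neg, abs_neg]; ring

lemma abs_add_rpow_sub_abs_sub_rpow_eq_zero {p a x : ℝ} (hp : 0 < p) (ha : 0 < a)
    (h : |x + a| ^ p - |x - a| ^ p = 0) : x = 0 := by
  rcases lt_trichotomy x 0 with hx | hx | hx
  · have := abs_add_rpow_sub_abs_sub_rpow_pos hp ha (neg_pos.mpr hx)
    rw [abs_neg_add_rpow_sub] at this
    linarith
  · exact hx
  · exact absurd h (abs_add_rpow_sub_abs_sub_rpow_pos hp ha hx).ne'

lemma eq_zero_of_rpow_balance {p a b x y : ℝ} (hp : 0 < p) (ha : 0 < a) (hb : 0 ≤ b)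
    (h₁ : (|x + a| ^ p - |x - a| ^ p) + (|y + b| ^ p - |y - b| ^ p) = 0)
    (h₂ : (|x + b| ^ p - |x - b| ^ p) - (|y + a| ^ p - |y - a| ^ p) = 0) : x = 0 ∧ y = 0 := by
  have key : ∀ x y : ℝ, 0 < x →
      (|x + a| ^ p - |x - a| ^ p) + (|y + b| ^ p - |y - b| ^ p) = 0 →
      (|x + b| ^ p - |x - b| ^ p) - (|y + a| ^ p - |y - a| ^ p) = 0 → False := by
    intro x y hx e₁ e₂
    have i₁ := abs_add_rpow_sub_abs_sub_rpow_pos hp ha hx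
    have i₂ := abs_add_rpow_sub_abs_sub_rpow_nonneg hp.le hb hx.le
    rcases le_or_gt 0 y with hy | hy
    · have := abs_add_rpow_sub_abs_sub_rpow_nonneg hp.le hb hy
      linarith
    · have := abs_add_rpow_sub_abs_sub_rpow_pos hp ha (neg_pos.mpr hy)
      rw [abs_neg_add_rpow_sub] at this
      linarith
  rcases lt_trichotomy x 0 with hx | hx | hx
  · refine (key (-x) (-y) (neg_pos.mpr hx) ?_ ?_).elim
    · simp only [abs_neg_add_rpow_sub]; linarith
    · simp only [abs_neg_add_rpow_sub]; linarith
  · refine ⟨hx, abs_add_rpow_sub_abs_sub_rpow_eq_zero hp ha ?_⟩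
    subst hx
    simp only [zero_add, zero_sub, abs_neg, sub_self] at h₂
    linarith
  · exact (key x y hx h₁ h₂).elim

/-- Two nonnegative numbers with prescribed `p`-norm, the first positive, such that the sum of
`p`-th powers of their sum and difference takes any value between its two extremes. -/
lemma exists_rpow_add_eq {p N t : ℝ} (hp : 1 ≤ p) (hN : 0 < N)
    (ht₁ : 2 ^ (p - 1) ≤ t) (ht₂ : t ≤ 2) :
    ∃ a b : ℝ, 0 < a ∧ 0 ≤ b ∧ a ^ p + b ^ p = N ∧ |a - b| ^ p + |a + b| ^ p = N * t := by
  have hp0 : 0 < p := by linarith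
  let φ : ℝ → ℝ := fun u => |(1 - u) ^ p⁻¹ - u ^ p⁻¹| ^ p + |(1 - u) ^ p⁻¹ + u ^ p⁻¹| ^ p
  have hφ : Continuous φ := by
    have h1 : Continuous fun u : ℝ => (1 - u) ^ p⁻¹ :=
      (continuous_const.sub continuous_id).rpow_const fun _ => Or.inr (by positivity)
    have h2 : Continuous fun u : ℝ => u ^ p⁻¹ :=
      continuous_id.rpow_const fun _ => Or.inr (by positivity)
    exact ((h1.sub h2).abs.rpow_const fun _ => Or.inr hp0.le).add
      ((h1.add h2).abs.rpow_const fun _ => Or.inr hp0.le)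
  have hφ0 : φ 0 = 2 := by
    simp only [φ, sub_zero, Real.one_rpow, Real.zero_rpow (inv_pos.mpr hp0).ne', add_zero, abs_one]
    norm_num
  have hφ1 : φ (1 / 2) = 2 ^ (p - 1) := by
    simp only [φ]
    rw [show (1 - 1 / 2 : ℝ) = 1 / 2 by norm_num, sub_self, abs_zero, Real.zero_rpow hp0.ne',
      zero_add, ← two_mul, abs_of_nonneg (by positivity),
      Real.mul_rpow (by norm_num) (by positivity), Real.rpow_inv_rpow (by norm_num) hp0.ne',
      Real.rpow_sub_one (by norm_num)]
    ring
  obtain ⟨u, ⟨hu0, hu1⟩, hu⟩ :=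
    intermediate_value_Icc' (by norm_num : (0 : ℝ) ≤ 1 / 2) hφ.continuousOn
      (show t ∈ Set.Icc (φ (1 / 2)) (φ 0) by rw [hφ0, hφ1]; exact ⟨ht₁, ht₂⟩)
  have h1u : 0 < 1 - u := by linarith
  have hs : (N ^ p⁻¹) ^ p = N := Real.rpow_inv_rpow hN.le hp0.ne'
  have hsp : 0 < N ^ p⁻¹ := Real.rpow_pos_of_pos hN _
  refine ⟨N ^ p⁻¹ * (1 - u) ^ p⁻¹, N ^ p⁻¹ * u ^ p⁻¹, by positivity, by positivity, ?_, ?_⟩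
  · rw [Real.mul_rpow hsp.le (by positivity), Real.mul_rpow hsp.le (by positivity), hs,
      Real.rpow_inv_rpow h1u.le hp0.ne', Real.rpow_inv_rpow hu0 hp0.ne']
    ring
  · rw [← mul_sub, ← mul_add, abs_mul, abs_mul, abs_of_pos hsp,
      Real.mul_rpow hsp.le (abs_nonneg _), Real.mul_rpow hsp.le (abs_nonneg _), hs, ← mul_add, ← hu]

/-- The block attached to a Hadamard matrix of order `n + 1`: an equilateral set of `2 (n + 1)`
points in `2 n + 1` coordinates whose points share the same prescribed norm and have the origin
as the only equidistant point. -/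
lemma exists_equilateral_block {p : ℝ} (hp : 1 ≤ p) (hp2 : p ≤ 2) {n : ℕ}
    {H : Matrix (Fin (n + 1)) (Fin (n + 1)) ℝ} (hH : IsHadamardMatrix H) {D β : ℝ}
    (hD : D = 2 ^ (1 - p) * (1 - 1 / ((n + 1 : ℕ) : ℝ))) (hDβ : D < β)
    (h₁ : 1 - 2 ^ p * (β - D) ≤ D * 2) (h₂ : D * 2 ^ (p - 1) ≤ 1 - 2 ^ p * (β - D)) :
    ∃ v : Fin (n + 1) × Bool → Option (Fin n × Bool) → ℝ,
      (∀ i j, i ≠ j → ∑ l, |v i l - v j l| ^ p = 1) ∧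
      (∀ i, ∑ l, |v i l| ^ p = β) ∧
      ∀ (x : Option (Fin n × Bool) → ℝ) (r : ℝ), (∀ i, ∑ l, |x l - v i l| ^ p = r) →
        ∀ l, x l = 0 := by
  have hp0 : 0 < p := by linarith
  obtain ⟨h, hs, ho, hi⟩ := hH.exists_core
  have h2pp : (2 : ℝ) ^ p = 2 * 2 ^ (p - 1) := by
    rw [Real.rpow_sub_one (by norm_num)]; ring
  have h2m : (2 : ℝ) ^ (1 - p) * 2 ^ (p - 1) = 1 := by
    rw [← Real.rpow_add (by norm_num)]; simp
  set N : ℝ := 2 ^ (1 - p) / ((n + 1 : ℕ) : ℝ) with hNdef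
  have hn1 : (0 : ℝ) < ((n + 1 : ℕ) : ℝ) := by positivity
  have hN : 0 < N := by positivity
  have hDN : D = n * N := by
    rw [hD, hNdef]; field_simp; push_cast; ring
  have hNn : 2 ^ (p - 1) * ((n + 1) * N) = 1 := by
    rw [hNdef, ← Nat.cast_succ, mul_div_cancel₀ _ hn1.ne', mul_comm, h2m]
  obtain ⟨t, ht₁, ht₂, ht⟩ : ∃ t : ℝ, 2 ^ (p - 1) ≤ t ∧ t ≤ 2 ∧
      D * t = 1 - 2 ^ p * (β - D) := by
    rcases (show 0 ≤ D by rw [hDN]; positivity).eq_or_lt with h0 | h0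
    · refine ⟨2 ^ (p - 1), le_rfl, ?_, ?_⟩
      · have := Real.rpow_le_rpow_of_exponent_le (one_le_two (α := ℝ)) (by linarith : p - 1 ≤ 1)
        rwa [Real.rpow_one] at this
      · rw [← h0] at h₁ h₂ ⊢; linarith
    · refine ⟨(1 - 2 ^ p * (β - D)) / D, ?_, ?_, by field_simp⟩
      · rw [le_div_iff₀ h0]; linarith
      · rw [div_le_iff₀ h0]; linarith
  obtain ⟨a, b, ha, hb, hab, hab'⟩ := exists_rpow_add_eq hp hN ht₁ ht₂
  obtain ⟨c, hc, hcp⟩ : ∃ c : ℝ, 0 < c ∧ c ^ p = β - D :=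
    ⟨(β - D) ^ p⁻¹, Real.rpow_pos_of_pos (by linarith) _,
      Real.rpow_inv_rpow (by linarith) hp0.ne'⟩
  let f : Bool → ℝ := fun s => if s then a else b
  let g : Bool → ℝ := fun s => if s then b else -a
  let e : Bool → ℝ := fun s => if s then c else -c
  let v : Fin (n + 1) × Bool → Option (Fin n × Bool) → ℝ := fun i l =>
    l.elim (e i.2) fun m => h i.1 m.1 * if m.2 then f i.2 else g i.2
  have hsum : ∀ F : Option (Fin n × Bool) → ℝ,
      ∑ l, F l = F none + ∑ j, (F (some (j, true)) + F (some (j, false))) := by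
    intro F
    simp [Fintype.sum_option, Fintype.sum_prod_type]
  have habs : ∀ i j, |h i j| = 1 := fun i j => by rcases hs i j with h | h <;> simp [h]
  have hfg : ∀ s, |f s| ^ p + |g s| ^ p = N := by
    intro s
    cases s <;> simp [f, g, abs_of_pos ha, abs_of_nonneg hb, ← hab, add_comm]
  have hee : ∀ s, |e s| ^ p = β - D := by
    intro s
    cases s <;> simp [e, abs_of_pos hc, hcp]
  have hcross : ∀ i i' j,
      |h i j * a - h i' j * b| ^ p + |h i j * b - h i' j * -a| ^ p = N * t := by
    intro i i' j
    rw [← hab']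
    rcases hs i j with h | h <;> rcases hs i' j with h' | h' <;> rw [h, h']
    · rw [show (1 * a - 1 * b) = a - b by ring, show (1 * b - 1 * -a) = a + b by ring]
    · rw [show (1 * a - -1 * b) = a + b by ring, show (1 * b - -1 * -a) = -(a - b) by ring,
        abs_neg, add_comm]
    · rw [show (-1 * a - 1 * b) = -(a + b) by ring, show (-1 * b - 1 * -a) = a - b by ring,
        abs_neg, add_comm]
    · rw [show (-1 * a - -1 * b) = -(a - b) by ring, show (-1 * b - -1 * -a) = -(a + b) by ring,
        abs_neg, abs_neg]
  have hcc : |c - -c| ^ p = 2 ^ p * (β - D) := by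
    rw [show c - -c = 2 * c by ring, abs_of_pos (by positivity),
      Real.mul_rpow (by norm_num) hc.le, hcp]
  have htb : ∀ i i', ∑ l, |v (i, true) l - v (i', false) l| ^ p = 1 := by
    intro i i'
    rw [hsum]
    simp only [v, e, f, g, Option.elim_none, Option.elim_some, if_true, Bool.false_eq_true,
      if_false, hcross, hcc, Finset.sum_const, Finset.card_univ, Fintype.card_fin, nsmul_eq_mul]
    rw [← mul_assoc, ← hDN, ht]; ring
  refine ⟨v, ?_, ?_, ?_⟩
  · rintro ⟨i, s⟩ ⟨i', s'⟩ hne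
    have hsame : i ≠ i' → ∀ s, ∑ l, |v (i, s) l - v (i', s) l| ^ p = 1 := by
      intro hii s
      have hterm : ∀ j, |h i j * f s - h i' j * f s| ^ p + |h i j * g s - h i' j * g s| ^ p
          = 2 ^ (p - 1) * N * (1 - h i j * h i' j) := by
        intro j
        rw [← hfg s, ← sub_mul, ← sub_mul, abs_mul, abs_mul,
          Real.mul_rpow (abs_nonneg _) (abs_nonneg _), Real.mul_rpow (abs_nonneg _) (abs_nonneg _)]
        have : |h i j - h i' j| ^ p = 2 ^ (p - 1) * (1 - h i j * h i' j) := by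
          rcases hs i j with h | h <;> rcases hs i' j with h' | h' <;> rw [h, h']
          · simp [Real.zero_rpow hp0.ne']
          · norm_num [h2pp]; ring
          · norm_num [h2pp]; ring
          · simp [Real.zero_rpow hp0.ne']
        rw [this]; ring
      rw [hsum]
      simp only [v, Option.elim_none, Option.elim_some, if_true, Bool.false_eq_true, if_false,
        hterm, sub_self, abs_zero, Real.zero_rpow hp0.ne', ← Finset.mul_sum,
        Finset.sum_sub_distrib, ho i i' hii, Finset.sum_const, Finset.card_univ, Fintype.card_fin,
        nsmul_eq_mul]
      linarith
    cases s <;> cases s'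
    · exact hsame (fun h => hne (by rw [h])) _
    · rw [← htb i' i]
      exact Finset.sum_congr rfl fun l _ => by rw [abs_sub_comm]
    · exact htb i i'
    · exact hsame (fun h => hne (by rw [h])) _
  · rintro ⟨i, s⟩
    rw [hsum]
    simp only [v, Option.elim_none, Option.elim_some, if_true, Bool.false_eq_true, if_false,
      abs_mul, habs, one_mul, hfg, hee, Finset.sum_const, Finset.card_univ, Fintype.card_fin,
      nsmul_eq_mul, ← hDN]
    ring
  · intro x r hx
    have hsplit : ∀ i j s,
        |x (some (j, true)) - h i j * f s| ^ p + |x (some (j, false)) - h i j * g s| ^ p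
        = ((|x (some (j, true)) + f s| ^ p + |x (some (j, true)) - f s| ^ p)
          + (|x (some (j, false)) + g s| ^ p + |x (some (j, false)) - g s| ^ p)) / 2
          - h i j * (((|x (some (j, true)) + f s| ^ p - |x (some (j, true)) - f s| ^ p)
          + (|x (some (j, false)) + g s| ^ p - |x (some (j, false)) - g s| ^ p)) / 2) := by
      intro i j s
      rcases hs i j with h | h <;> rw [h]
      · simp only [one_mul]; ring
      · simp only [neg_one_mul, sub_neg_eq_add]; ring
    have hB : ∀ s j, ((|x (some (j, true)) + f s| ^ p - |x (some (j, true)) - f s| ^ p)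
          + (|x (some (j, false)) + g s| ^ p - |x (some (j, false)) - g s| ^ p)) / 2 = 0 := by
      intro s
      refine hi _ (|x none - e s| ^ p + ∑ j,
        ((|x (some (j, true)) + f s| ^ p + |x (some (j, true)) - f s| ^ p)
          + (|x (some (j, false)) + g s| ^ p + |x (some (j, false)) - g s| ^ p)) / 2 - r) ?_
      intro i
      have := hx (i, s)
      rw [hsum] at this
      simp only [v, Option.elim_none, Option.elim_some, if_true, Bool.false_eq_true, if_false,
        hsplit, Finset.sum_sub_distrib] at this
      linarith
    have hxy : ∀ j, x (some (j, true)) = 0 ∧ x (some (j, false)) = 0 := by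
      intro j
      have e₁ := hB true j
      have e₂ := hB false j
      simp only [f, g, if_true, Bool.false_eq_true, if_false, sub_neg_eq_add,
        ← sub_eq_add_neg] at e₁ e₂
      exact eq_zero_of_rpow_balance hp0 ha hb (by linarith) (by linarith)
    have hx0 : x none = 0 := by
      have e₁ := hx (0, true)
      have e₂ := hx (0, false)
      rw [hsum] at e₁ e₂
      simp only [v, Option.elim_none, Option.elim_some, if_true, Bool.false_eq_true, if_false,
        hxy, zero_sub, abs_neg, abs_mul, habs, one_mul, hfg] at e₁ e₂
      refine abs_add_rpow_sub_abs_sub_rpow_eq_zero hp0 hc ?_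
      simp only [e, if_true, Bool.false_eq_true, if_false, sub_neg_eq_add] at e₁ e₂
      linarith
    rintro (_ | ⟨j, _ | _⟩)
    exacts [hx0, (hxy j).2, (hxy j).1]

/-- Admissible `p`-th powers of the radii of the two blocks, chosen distinct. -/
lemma exists_block_radii {s D₁ D₂ : ℝ} (hs : 1 / 2 < s) (hs1 : s ≤ 1)
    (hD₁ : D₁ = 0 ∨ s / 2 ≤ D₁) (hD₂ : D₂ = 0 ∨ s / 2 ≤ D₂) (hD₁s : D₁ < s) (hD₂s : D₂ < s)
    (hlt : D₁ + D₂ < 1) (hgt : 2 - 2 * s < D₁ + D₂)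
    (h₁ : (1 - s) * D₁ + D₂ < 1 - s / 2) (h₂ : D₁ + (1 - s) * D₂ < 1 - s / 2) :
    ∃ β₁ β₂ : ℝ, β₁ ≠ β₂ ∧ β₁ + β₂ = 1 ∧
      (D₁ < β₁ ∧ D₁ * (1 - s) + s / 2 ≤ β₁ ∧ β₁ ≤ (D₁ + s) / 2) ∧
      (D₂ < β₂ ∧ D₂ * (1 - s) + s / 2 ≤ β₂ ∧ β₂ ≤ (D₂ + s) / 2) := by
  have hs1' : s < 1 := by
    refine lt_of_le_of_ne hs1 fun h => ?_
    subst h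
    rcases hD₁ with h | h <;> rcases hD₂ with h' | h' <;> linarith
  rcases hD₁ with rfl | hD₁
  · exact ⟨s / 2, 1 - s / 2, by intro h; linarith, by ring,
      ⟨by linarith, by linarith, by linarith⟩, ⟨by linarith, by nlinarith, by linarith⟩⟩
  rcases hD₂ with rfl | hD₂
  · exact ⟨1 - s / 2, s / 2, by intro h; linarith, by ring,
      ⟨by linarith, by nlinarith, by linarith⟩, ⟨by linarith, by linarith, by linarith⟩⟩
  have hne : max (max D₁ (D₁ * (1 - s) + s / 2)) (1 - (D₂ + s) / 2) <
      min (min (1 - D₂) (1 - (D₂ * (1 - s) + s / 2))) ((D₁ + s) / 2) := by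
    simp only [max_lt_iff, lt_min_iff]
    refine ⟨⟨⟨⟨?_, ?_⟩, ?_⟩, ⟨?_, ?_⟩, ?_⟩, ⟨?_, ?_⟩, ?_⟩ <;> nlinarith
  obtain ⟨β, hβ, hl, hu⟩ : ∃ β : ℝ, β ≠ 1 / 2 ∧
      max (max D₁ (D₁ * (1 - s) + s / 2)) (1 - (D₂ + s) / 2) < β ∧
      β < min (min (1 - D₂) (1 - (D₂ * (1 - s) + s / 2))) ((D₁ + s) / 2) := by
    obtain ⟨x, hx₁, hx₂⟩ := exists_between hne
    obtain ⟨y, hy₁, hy₂⟩ := exists_between hx₂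
    by_cases hx : x = 1 / 2
    · exact ⟨y, by rw [← hx]; exact hy₁.ne', hx₁.trans hy₁, hy₂⟩
    · exact ⟨x, hx, hx₁, hx₂⟩
  simp only [max_lt_iff, lt_min_iff] at hl hu
  exact ⟨β, 1 - β, fun h => hβ (by linarith), by ring,
    ⟨hl.1.1, hl.1.2.le, hu.2.le⟩, ⟨by linarith, by linarith, by linarith⟩⟩

/-- A finite `1`-equilateral family in `ℓ_p^d` without equidistant points yields a maximal
equilateral set in every sum `ℓ_p^d ⊕_q X`. -/
lemma exists_maximalEquilateral_of_no_equidistant {p q : ℝ} (hp : 1 ≤ p) (hq : 1 ≤ q)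
    (X : Type*) [NormedAddCommGroup X] {d : ℕ} {ι : Type*} [Fintype ι] [Nontrivial ι]
    (u : ι → Fin d → ℝ) (hu : ∀ i j, i ≠ j → ∑ l, |u i l - u j l| ^ p = 1)
    (hx : ∀ (x : Fin d → ℝ) (r : ℝ), ¬ ∀ i, ∑ l, |x l - u i l| ^ p = r) :
    letI : Fact (1 ≤ ENNReal.ofReal p) := ⟨ENNReal.one_le_ofReal.mpr hp⟩
    letI : Fact (1 ≤ ENNReal.ofReal q) := ⟨ENNReal.one_le_ofReal.mpr hq⟩
    ∃ A : Set (WithLp (ENNReal.ofReal q)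
        ((PiLp (ENNReal.ofReal p) fun _ : Fin d => ℝ) × X)),
      MaximalEquilateral A ∧ A.Finite ∧ A.ncard ≤ Fintype.card ι := by
  have : Fact (1 ≤ ENNReal.ofReal p) := ⟨ENNReal.one_le_ofReal.mpr hp⟩
  have : Fact (1 ≤ ENNReal.ofReal q) := ⟨ENNReal.one_le_ofReal.mpr hq⟩
  have hp0 : 0 < p := by linarith
  have hq0 : 0 < q := by linarith
  have hpt : (ENNReal.ofReal p).toReal = p := ENNReal.toReal_ofReal hp0.le
  have hqt : (ENNReal.ofReal q).toReal = q := ENNReal.toReal_ofReal hq0.le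
  let F : ι → WithLp (ENNReal.ofReal q) ((PiLp (ENNReal.ofReal p) fun _ : Fin d => ℝ) × X) :=
    fun i => WithLp.toLp _ (WithLp.toLp _ (u i), 0)
  have hnorm : ∀ z : PiLp (ENNReal.ofReal p) fun _ : Fin d => ℝ,
      ‖z‖ = (∑ l, |z l| ^ p) ^ (1 / p) := by
    intro z
    rw [PiLp.norm_eq_sum (by rw [hpt]; exact hp0), hpt]
    simp only [Real.norm_eq_abs]
  have hnorm' : ∀ z : WithLp (ENNReal.ofReal q)
      ((PiLp (ENNReal.ofReal p) fun _ : Fin d => ℝ) × X),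
      ‖z‖ = (‖z.fst‖ ^ q + ‖z.snd‖ ^ q) ^ (1 / q) := by
    intro z
    rw [WithLp.prod_norm_eq_add (by rw [hqt]; exact hq0), hqt]
  have hfst : ∀ i l, (F i).fst l = u i l := fun _ _ => rfl
  have hsnd : ∀ i, (F i).snd = 0 := fun _ => rfl
  have hFF : ∀ i j, i ≠ j → ‖F i - F j‖ = 1 := by
    intro i j hij
    rw [hnorm', hnorm]
    simp [F, hu i j hij, Real.zero_rpow hq0.ne']
  refine ⟨Set.range F, ⟨⟨1, one_pos, ?_⟩, ?_⟩, Set.finite_range F, ?_⟩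
  · rintro _ ⟨i, rfl⟩ _ ⟨j, rfl⟩ hne
    exact hFF i j fun h => hne (by rw [h])
  · rintro B ⟨lam, hlam, hB⟩ hAB
    refine Set.Subset.antisymm (fun x hxB => ?_) hAB
    by_contra hxA
    refine hx x.fst (((lam ^ q - ‖x.snd‖ ^ q) ^ q⁻¹) ^ p) fun i => ?_
    have hdist : ‖x - F i‖ = lam :=
      hB hxB (hAB ⟨i, rfl⟩) fun h => hxA ⟨i, h.symm⟩
    have hS : 0 ≤ ∑ l, |x.fst l - u i l| ^ p :=
      Finset.sum_nonneg fun l _ => by positivity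
    rw [hnorm', hnorm, one_div q, Real.rpow_inv_eq (by positivity) hlam.le hq0.ne'] at hdist
    simp only [WithLp.sub_fst, WithLp.sub_snd, PiLp.sub_apply, hfst, hsnd, sub_zero] at hdist
    rw [← hdist, add_sub_cancel_right, Real.rpow_rpow_inv (by positivity) hq0.ne', one_div,
      Real.rpow_inv_rpow hS hp0.ne']
  · rw [← Set.image_univ, ← Nat.card_eq_fintype_card, ← Set.ncard_univ]
    exact Set.ncard_image_le Set.finite_univ

/-- Two equilateral blocks in complementary coordinates, with the origin as only equidistant
point and with distinct radii whose `p`-th powers add up to one, yield a maximal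
equilateral set. -/
lemma exists_maximalEquilateral_of_blocks {p q : ℝ} (hp : 1 ≤ p) (hq : 1 ≤ q)
    (X : Type*) [NormedAddCommGroup X] {d : ℕ} {ι₁ ι₂ κ₁ κ₂ : Type*}
    [Fintype ι₁] [Fintype ι₂] [Fintype κ₁] [Fintype κ₂] [Nonempty ι₁] [Nonempty ι₂]
    (hd : Fintype.card κ₁ + Fintype.card κ₂ ≤ d) {β₁ β₂ : ℝ} (hne : β₁ ≠ β₂) (hβ : β₁ + β₂ = 1)
    (v₁ : ι₁ → κ₁ → ℝ) (v₂ : ι₂ → κ₂ → ℝ)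
    (hv₁ : ∀ i j, i ≠ j → ∑ l, |v₁ i l - v₁ j l| ^ p = 1)
    (hv₂ : ∀ i j, i ≠ j → ∑ l, |v₂ i l - v₂ j l| ^ p = 1)
    (hβ₁ : ∀ i, ∑ l, |v₁ i l| ^ p = β₁) (hβ₂ : ∀ i, ∑ l, |v₂ i l| ^ p = β₂)
    (hx₁ : ∀ (x : κ₁ → ℝ) (r : ℝ), (∀ i, ∑ l, |x l - v₁ i l| ^ p = r) → ∀ l, x l = 0)
    (hx₂ : ∀ (x : κ₂ → ℝ) (r : ℝ), (∀ i, ∑ l, |x l - v₂ i l| ^ p = r) → ∀ l, x l = 0) :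
    letI : Fact (1 ≤ ENNReal.ofReal p) := ⟨ENNReal.one_le_ofReal.mpr hp⟩
    letI : Fact (1 ≤ ENNReal.ofReal q) := ⟨ENNReal.one_le_ofReal.mpr hq⟩
    ∃ A : Set (WithLp (ENNReal.ofReal q)
        ((PiLp (ENNReal.ofReal p) fun _ : Fin d => ℝ) × X)),
      MaximalEquilateral A ∧ A.Finite ∧ A.ncard ≤ Fintype.card ι₁ + Fintype.card ι₂ := by
  classical
  have hp0 : p ≠ 0 := by linarith
  obtain ⟨e⟩ : Nonempty (κ₁ ⊕ κ₂ ↪ Fin d) :=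
    Function.Embedding.nonempty_of_card_le (by simpa using hd)
  let w : ι₁ ⊕ ι₂ → κ₁ ⊕ κ₂ → ℝ :=
    Sum.elim (fun i => Sum.elim (v₁ i) 0) (fun i => Sum.elim 0 (v₂ i))
  let u : ι₁ ⊕ ι₂ → Fin d → ℝ := fun i => Function.extend e (w i) 0
  have hue : ∀ i l, u i (e l) = w i l := fun i l => e.injective.extend_apply _ _ _
  have hu0 : ∀ i l, l ∉ Set.range e → u i l = 0 := fun i l hl =>
    Function.extend_apply' _ _ _ hl
  have hsplit : ∀ G : Fin d → ℝ, ∑ l, G l = ∑ l, G (e (Sum.inl l)) + ∑ l, G (e (Sum.inr l))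
      + ∑ l with l ∉ Set.range e, G l := by
    intro G
    rw [← Finset.sum_filter_add_sum_filter_not Finset.univ (fun l => l ∈ Set.range e) G,
      ← Fintype.sum_sum_type (fun l => G (e l))]
    congr 1
    rw [← Finset.sum_image (f := G) (s := Finset.univ) (g := e) e.injective.injOn]
    congr 1
    ext l
    simp
  have hdist : ∀ (x : Fin d → ℝ) i, ∑ l, |x l - u i l| ^ p
      = ∑ l, |x (e (Sum.inl l)) - w i (Sum.inl l)| ^ p
        + ∑ l, |x (e (Sum.inr l)) - w i (Sum.inr l)| ^ p
        + ∑ l with l ∉ Set.range e, |x l| ^ p := by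
    intro x i
    rw [hsplit]
    simp only [hue]
    congr 1
    refine Finset.sum_congr rfl fun l hl => ?_
    rw [hu0 i l (Finset.mem_filter.mp hl).2, sub_zero]
  have hrest : ∀ i, ∑ l with l ∉ Set.range e, |u i l| ^ p = 0 := by
    intro i
    refine Finset.sum_eq_zero fun l hl => ?_
    rw [hu0 i l (Finset.mem_filter.mp hl).2, abs_zero, Real.zero_rpow hp0]
  have : Nontrivial (ι₁ ⊕ ι₂) :=
    ⟨Sum.inl (Classical.arbitrary ι₁), Sum.inr (Classical.arbitrary ι₂), Sum.inl_ne_inr⟩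
  rw [← Fintype.card_sum]
  refine exists_maximalEquilateral_of_no_equidistant hp hq X u ?_ ?_
  · intro i j hij
    rw [hdist, hrest]
    simp only [hue]
    rcases i with i | i <;> rcases j with j | j
    · simp [w, hv₁ i j (fun h => hij (by rw [h])), Real.zero_rpow hp0]
    · simp [w, hβ₁, hβ₂, hβ]
    · simp [w, hβ₁, hβ₂, hβ]
    · simp [w, hv₂ i j (fun h => hij (by rw [h])), Real.zero_rpow hp0]
  · intro x r hr
    simp only [hdist] at hr
    have z₁ := hx₁ (fun l => x (e (Sum.inl l)))
      (r - ∑ l, |x (e (Sum.inr l))| ^ p - ∑ l with l ∉ Set.range e, |x l| ^ p) fun i => by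
        have := hr (Sum.inl i)
        simp only [w, Sum.elim_inl, Sum.elim_inr, Pi.zero_apply, sub_zero] at this
        linarith
    have z₂ := hx₂ (fun l => x (e (Sum.inr l)))
      (r - ∑ l, |x (e (Sum.inl l))| ^ p - ∑ l with l ∉ Set.range e, |x l| ^ p) fun i => by
        have := hr (Sum.inr i)
        simp only [w, Sum.elim_inl, Sum.elim_inr, Pi.zero_apply, sub_zero] at this
        linarith
    have r₁ := hr (Sum.inl (Classical.arbitrary ι₁))
    have r₂ := hr (Sum.inr (Classical.arbitrary ι₂))
    simp only [w, Sum.elim_inl, Sum.elim_inr, Pi.zero_apply, z₁, z₂, zero_sub, abs_neg, abs_zero,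
      Real.zero_rpow hp0, Finset.sum_const_zero, hβ₁, hβ₂] at r₁ r₂
    exact hne (by linarith)

/-- Let `p ∈ [1,2)`, `q ∈ [1,∞)`, and let `X` be any normed space.
Let `k₁, k₂ ∈ ℕ` (positive) be orders of Hadamard matrices satisfying
(i) `2 − 2^{p−1} < 1/k₁ + 1/k₂ < 4 − 2^p`,
(ii) `(1 − 2^{−p})(2 − 2^{p−1}) < (1 − 2^{1−p})/k₁ + 1/k₂`, and
(iii) `(1 − 2^{−p})(2 − 2^{p−1}) < 1/k₁ + (1 − 2^{1−p})/k₂`.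
Then `m(ℓ_p^d ⊕_q X) ≤ 2(k₁ + k₂)` for all `d ≥ 2(k₁ + k₂ − 1)`. -/
theorem statement16 (p : ℝ) (hp1 : 1 ≤ p) (hp2 : p < 2) (q : ℝ) (hq : 1 ≤ q)
    (X : Type*) [NormedAddCommGroup X] [NormedSpace ℝ X]
    (k₁ k₂ : ℕ) (hk₁ : 1 ≤ k₁) (hk₂ : 1 ≤ k₂)
    (hH₁ : ∃ H : Matrix (Fin k₁) (Fin k₁) ℝ, IsHadamardMatrix H)
    (hH₂ : ∃ H : Matrix (Fin k₂) (Fin k₂) ℝ, IsHadamardMatrix H)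
    (hi : 2 - (2 : ℝ) ^ (p - 1) < 1 / (k₁ : ℝ) + 1 / (k₂ : ℝ))
    (hi' : 1 / (k₁ : ℝ) + 1 / (k₂ : ℝ) < 4 - (2 : ℝ) ^ p)
    (hii : (1 - (2 : ℝ) ^ (-p)) * (2 - (2 : ℝ) ^ (p - 1)) <
      (1 - (2 : ℝ) ^ (1 - p)) / (k₁ : ℝ) + 1 / (k₂ : ℝ))
    (hiii : (1 - (2 : ℝ) ^ (-p)) * (2 - (2 : ℝ) ^ (p - 1)) <
      1 / (k₁ : ℝ) + (1 - (2 : ℝ) ^ (1 - p)) / (k₂ : ℝ)) :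
    ∀ d : ℕ, 2 * (k₁ + k₂ - 1) ≤ d →
      letI : Fact (1 ≤ ENNReal.ofReal p) := ⟨ENNReal.one_le_ofReal.mpr hp1⟩
      letI : Fact (1 ≤ ENNReal.ofReal q) := ⟨ENNReal.one_le_ofReal.mpr hq⟩
      ∃ A : Set (WithLp (ENNReal.ofReal q)
          ((PiLp (ENNReal.ofReal p) fun _ : Fin d => ℝ) × X)),
        MaximalEquilateral A ∧ A.Finite ∧ A.ncard ≤ 2 * (k₁ + k₂) := by
  intro d hd
  have hp0 : 0 < p := by linarith
  obtain ⟨n₁, rfl⟩ := Nat.exists_eq_add_of_le' hk₁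
  obtain ⟨n₂, rfl⟩ := Nat.exists_eq_add_of_le' hk₂
  obtain ⟨H₁, hH₁⟩ := hH₁
  obtain ⟨H₂, hH₂⟩ := hH₂
  set s : ℝ := 2 ^ (1 - p) with hs
  have hs0 : 0 < s := by positivity
  have hs_half : 1 / 2 < s := by
    have := Real.rpow_lt_rpow_of_exponent_lt (one_lt_two (α := ℝ)) (by linarith : -1 < 1 - p)
    rwa [Real.rpow_neg_one, ← one_div] at this
  have hs1 : s ≤ 1 := Real.rpow_le_one_of_one_le_of_nonpos one_le_two (by linarith)
  have e₁ : (2 : ℝ) ^ (p - 1) = 1 / s := by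
    rw [hs, one_div, ← Real.rpow_neg (by norm_num), neg_sub]
  have e₂ : (2 : ℝ) ^ p = 2 / s := by
    rw [show p = p - 1 + 1 by ring, Real.rpow_add_one (by norm_num), e₁]; ring
  have e₃ : (2 : ℝ) ^ (-p) = s / 2 := by
    rw [Real.rpow_neg (by norm_num), e₂, inv_div]
  have hD : ∀ n : ℕ, s * (1 - 1 / ((n + 1 : ℕ) : ℝ)) = 0 ∨
      s / 2 ≤ s * (1 - 1 / ((n + 1 : ℕ) : ℝ)) := by
    intro n
    rcases n.eq_zero_or_pos with rfl | hn
    · left; simp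
    · right
      have : 1 / ((n + 1 : ℕ) : ℝ) ≤ 1 / 2 :=
        one_div_le_one_div_of_le (by norm_num) (by exact_mod_cast Nat.succ_le_succ hn)
      nlinarith
  have hDs : ∀ n : ℕ, s * (1 - 1 / ((n + 1 : ℕ) : ℝ)) < s := by
    intro n
    have : 0 < 1 / ((n + 1 : ℕ) : ℝ) := by positivity
    nlinarith
  rw [e₁, e₃, div_eq_mul_one_div (1 - s)] at hii hiii
  rw [e₁] at hi
  rw [e₂] at hi'
  have hD₁ := hD n₁
  have hD₂ := hD n₂
  have hDs₁ := hDs n₁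
  have hDs₂ := hDs n₂
  generalize hK₁ : 1 / ((n₁ + 1 : ℕ) : ℝ) = K₁ at *
  generalize hK₂ : 1 / ((n₂ + 1 : ℕ) : ℝ) = K₂ at *
  have hsi : s * (1 / s) = 1 := by field_simp
  obtain ⟨β₁, β₂, hne, hβ, ⟨a₁, b₁, c₁⟩, ⟨a₂, b₂, c₂⟩⟩ :=
    exists_block_radii hs_half hs1 hD₁ hD₂ hDs₁ hDs₂
      (by linear_combination s * hi + hsi)
      (by linear_combination s * hi' - 2 * hsi)
      (by linear_combination s * hii + (1 - s / 2) * hsi)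
      (by linear_combination s * hiii + (1 - s / 2) * hsi)
  have lower : ∀ D β : ℝ, D * (1 - s) + s / 2 ≤ β → 1 - 2 ^ p * (β - D) ≤ D * 2 := by
    intro D β h
    rw [e₂]
    have := mul_le_mul_of_nonneg_left h (by positivity : 0 ≤ 2 / s)
    field_simp at this ⊢
    linarith
  have upper : ∀ D β : ℝ, β ≤ (D + s) / 2 → D * 2 ^ (p - 1) ≤ 1 - 2 ^ p * (β - D) := by
    intro D β h
    rw [e₁, e₂]
    field_simp
    linarith
  obtain ⟨v₁, f₁, g₁, h₁⟩ := exists_equilateral_block hp1 hp2.le hH₁ (by rw [← hs, hK₁]) a₁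
    (lower _ _ b₁) (upper _ _ c₁)
  obtain ⟨v₂, f₂, g₂, h₂⟩ := exists_equilateral_block hp1 hp2.le hH₂ (by rw [← hs, hK₂]) a₂
    (lower _ _ b₂) (upper _ _ c₂)
  have hcard : 2 * (n₁ + 1 + (n₂ + 1)) =
      Fintype.card (Fin (n₁ + 1) × Bool) + Fintype.card (Fin (n₂ + 1) × Bool) := by
    simp; ring
  rw [hcard]
  exact exists_maximalEquilateral_of_blocks hp1 hq X (by simp; omega) hne hβ v₁ v₂
    f₁ f₂ g₁ g₂ h₁ h₂
end

section
/- For each p ∈ [1,2) there exist C = C(p) ∈ ℕ and d_0 = d_0(p) ∈ ℕ such that for every integer d ≥ d_0, every normed space X, and every q ∈ [1,∞), one has m(ℓ_p^d ⊕_q X) ≤ C; in particular m(ℓ_p^d) ≤ C for all d ≥ d_0. -/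
/-- `RigidSimplex p L N`: some finite family in a finite-dimensional `ℓ_p` space has pairwise
distances `L ^ (1 / p)`, all norms `N ^ (1 / p)`, and the origin as its only possible
equidistant point. -/
def RigidSimplex (p L N : ℝ) : Prop :=
  ∃ (κ ι : Type) (_ : Fintype κ) (_ : Fintype ι) (_ : Nonempty κ) (x : κ → ι → ℝ),
    (∀ k k', k ≠ k' → ∑ i, |x k i - x k' i| ^ p = L) ∧
    (∀ k, ∑ i, |x k i| ^ p = N) ∧
    ∀ (u : ι → ℝ) (c : ℝ), (∀ k, ∑ i, |x k i - u i| ^ p = c) → u = 0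

/-- Some finite family in a finite-dimensional `ℓ_p` space is equilateral and has no
equidistant point. -/
def HasCenterlessSimplex (p : ℝ) : Prop :=
  ∃ (κ ι : Type) (_ : Fintype κ) (_ : Fintype ι) (_ : Nonempty κ) (x : κ → ι → ℝ) (L : ℝ),
    0 < L ∧ (∀ k k', k ≠ k' → ∑ i, |x k i - x k' i| ^ p = L) ∧
    ∀ (u : ι → ℝ) (c : ℝ), ¬ ∀ k, ∑ i, |x k i - u i| ^ p = c

theorem RigidSimplex.scale {p L N t : ℝ} (hp : 1 ≤ p) (ht : 0 < t) (h : RigidSimplex p L N) :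
    RigidSimplex p (t * L) (t * N) := by
  obtain ⟨κ, ι, _, _, hκ, x, hL, hN, hu⟩ := h
  set s : ℝ := t ^ p⁻¹ with hs
  have hs0 : 0 < s := Real.rpow_pos_of_pos ht _
  have hst : s ^ p = t := Real.rpow_inv_rpow ht.le (by positivity)
  have key : ∀ y : ℝ, |s * y| ^ p = t * |y| ^ p := fun y => by
    rw [abs_mul, abs_of_pos hs0, Real.mul_rpow hs0.le (abs_nonneg _), hst]
  refine ⟨κ, ι, inferInstance, inferInstance, hκ, fun k i => s * x k i, fun k k' hk => ?_, fun k => ?_, fun u c h => ?_⟩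
  · simp_rw [← mul_sub, key, ← Finset.mul_sum, hL k k' hk]
  · simp_rw [key, ← Finset.mul_sum, hN k]
  · have h0 : (fun i => s⁻¹ * u i) = 0 := by
      refine hu _ (t⁻¹ * c) fun k => ?_
      rw [← h k, Finset.mul_sum]
      refine Finset.sum_congr rfl fun i _ => ?_
      have : s * x k i - u i = s * (x k i - s⁻¹ * u i) := by field_simp
      rw [this, key]
      field_simp
    funext i
    have := congrFun h0 i
    simpa [hs0.ne'] using this

theorem RigidSimplex.normalize {p L N : ℝ} (hp : 1 ≤ p) (hL : 0 < L) (h : RigidSimplex p L N) :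
    RigidSimplex p 1 (N / L) := by
  have := h.scale hp (inv_pos.2 hL)
  rwa [inv_mul_cancel₀ hL.ne', ← div_eq_inv_mul] at this

/-- Attach to each point of the first simplex a copy of the second one, in fresh coordinates. -/
theorem RigidSimplex.comp {p L₁ N₁ L₂ N₂ : ℝ} (hp : 1 ≤ p) (h₁ : RigidSimplex p L₁ N₁)
    (h₂ : RigidSimplex p L₂ N₂) (h : L₁ + 2 * N₂ = L₂) : RigidSimplex p L₂ (N₁ + N₂) := by
  classical
  obtain ⟨κ₁, ι₁, _, _, _, x, hxL, hxN, hxu⟩ := h₁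
  obtain ⟨κ₂, ι₂, _, _, _, y, hyL, hyN, hyu⟩ := h₂
  have hp0 : p ≠ 0 := by positivity
  have z0 : |(0 : ℝ)| ^ p = 0 := by simp [hp0]
  refine ⟨κ₁ × κ₂, ι₁ ⊕ κ₁ × ι₂, inferInstance, inferInstance, inferInstance,
    fun k => Sum.elim (x k.1) fun j => if j.1 = k.1 then y k.2 j.2 else 0, ?_, ?_, ?_⟩
  · rintro ⟨k, m⟩ ⟨k', m'⟩ hne
    simp only [Fintype.sum_sum_type, Sum.elim_inl, Sum.elim_inr, Fintype.sum_prod_type]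
    by_cases hk : k = k'
    · subst hk
      have hm : m ≠ m' := fun h => hne (by rw [h])
      rw [Finset.sum_eq_zero fun i _ => by rw [sub_self, z0], zero_add,
        Finset.sum_eq_single k (fun a _ ha => by simp [ha, hp0]) (by simp)]
      simpa using hyL m m' hm
    · rw [hxL k k' hk, ← h, add_right_inj,
        Finset.sum_eq_add k k' hk (fun a _ ha => by simp [ha.1, ha.2, hp0]) (by simp) (by simp)]
      simp [hk, Ne.symm hk, hyN, two_mul]
  · rintro ⟨k, m⟩
    simp only [Fintype.sum_sum_type, Sum.elim_inl, Sum.elim_inr, Fintype.sum_prod_type]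
    rw [hxN, add_right_inj, Finset.sum_eq_single k (fun a _ ha => by simp [ha, hp0]) (by simp)]
    simpa using hyN m
  · intro u c hc
    simp only [Fintype.sum_sum_type, Sum.elim_inl, Sum.elim_inr, Fintype.sum_prod_type,
      Prod.forall] at hc
    have hv : ∀ k j, u (Sum.inr (k, j)) = 0 := fun k j => by
      refine congrFun (hyu (fun j => u (Sum.inr (k, j))) (c - ∑ i, |x k i - u (Sum.inl i)| ^ p -
        ∑ a ∈ Finset.univ.erase k, ∑ j, |u (Sum.inr (a, j))| ^ p) fun m => ?_) j
      rw [← hc k m, ← Finset.add_sum_erase _ _ (Finset.mem_univ k)]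
      have : ∑ a ∈ Finset.univ.erase k, ∑ j,
          |(if a = k then y m j else 0) - u (Sum.inr (a, j))| ^ p =
          ∑ a ∈ Finset.univ.erase k, ∑ j, |u (Sum.inr (a, j))| ^ p :=
        Finset.sum_congr rfl fun a ha => by simp [Finset.ne_of_mem_erase ha]
      rw [this]
      simp
    have hw := hxu (fun i => u (Sum.inl i)) (c - N₂) fun k => by
      obtain ⟨m⟩ := ‹Nonempty κ₂›
      rw [← hc k m, Finset.sum_eq_single (s := Finset.univ (α := κ₁)) k
        (fun a _ ha => by simp [ha, hp0, hv]) (by simp)]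
      simp [hv, hyN]
    funext j
    rcases j with i | ⟨k, j⟩
    · exact congrFun hw i
    · exact hv k j

theorem RigidSimplex.mul {p X Y : ℝ} (hp : 1 ≤ p) (hY : 0 < Y)
    (hX : RigidSimplex p 1 ((1 - X) / 2)) (hYs : RigidSimplex p 1 ((1 - Y) / 2)) :
    RigidSimplex p 1 ((1 - X * Y) / 2) := by
  have := (hX.scale hp hY).comp hp hYs (by ring)
  convert this using 1
  ring

theorem RigidSimplex.mul_pow {p X Y : ℝ} (hp : 1 ≤ p) (hY : 0 < Y)
    (hX : RigidSimplex p 1 ((1 - X) / 2)) (hYs : RigidSimplex p 1 ((1 - Y) / 2)) (n : ℕ) :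
    RigidSimplex p 1 ((1 - X * Y ^ n) / 2) := by
  induction n with
  | zero => simpa using hX
  | succ n ih => rw [pow_succ, ← mul_assoc]; exact ih.mul hp hY hYs

theorem RigidSimplex.pow {p Y : ℝ} (hp : 1 ≤ p) (hY : 0 < Y)
    (hYs : RigidSimplex p 1 ((1 - Y) / 2)) {n : ℕ} (hn : n ≠ 0) :
    RigidSimplex p 1 ((1 - Y ^ n) / 2) := by
  obtain ⟨n, rfl⟩ := Nat.exists_eq_succ_of_ne_zero hn
  rw [pow_succ']
  exact hYs.mul_pow hp hY hYs n

/-- Two rigid simplices in complementary coordinates, with different circumradii. -/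
theorem HasCenterlessSimplex.of_rigid {p N₁ N₂ : ℝ} (hp : 1 ≤ p) (h₁ : RigidSimplex p 1 N₁)
    (h₂ : RigidSimplex p 1 N₂) (h : N₁ + N₂ = 1) (hne : N₁ ≠ N₂) : HasCenterlessSimplex p := by
  obtain ⟨κ₁, ι₁, _, _, _, x, hxL, hxN, hxu⟩ := h₁
  obtain ⟨κ₂, ι₂, _, _, _, y, hyL, hyN, hyu⟩ := h₂
  have hp0 : p ≠ 0 := by positivity
  refine ⟨κ₁ ⊕ κ₂, ι₁ ⊕ ι₂, inferInstance, inferInstance, inferInstance,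
    Sum.elim (fun k => Sum.elim (x k) 0) (fun k => Sum.elim 0 (y k)), 1, one_pos, ?_, ?_⟩
  · rintro (k | k) (k' | k') hk
    · simpa [hp0] using hxL k k' (by simpa using hk)
    · simpa [hxN, hyN] using h
    · simpa [hxN, hyN, add_comm] using h
    · simpa [hp0] using hyL k k' (by simpa using hk)
  · intro u c hc
    simp only [Fintype.sum_sum_type, Sum.forall, Sum.elim_inl, Sum.elim_inr, Pi.zero_apply,
      zero_sub, abs_neg] at hc
    have h1 := hxu (fun i => u (Sum.inl i)) _ fun k => eq_sub_of_add_eq (hc.1 k)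
    have h2 := hyu (fun i => u (Sum.inr i)) _ fun k => eq_sub_of_add_eq' (hc.2 k)
    obtain ⟨k⟩ := ‹Nonempty κ₁›
    obtain ⟨m⟩ := ‹Nonempty κ₂›
    have e1 := hc.1 k
    have e2 := hc.2 m
    have h1' : ∀ i, u (Sum.inl i) = 0 := congrFun h1
    have h2' : ∀ i, u (Sum.inr i) = 0 := congrFun h2
    simp only [h1', h2', sub_zero, abs_zero, Real.zero_rpow hp0, Finset.sum_const_zero,
      add_zero, zero_add, hxN, hyN] at e1 e2
    exact hne (e1.trans e2.symm)

/-- In `ℓ_1` a rigid simplex of circumradius more than half its side is completed by one point. -/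
theorem HasCenterlessSimplex.of_rigid_one {L N : ℝ} (h : RigidSimplex 1 L N) (h0 : 0 < L)
    (hNL : N ≤ L) (hLN : L < 2 * N) : HasCenterlessSimplex 1 := by
  obtain ⟨κ, ι, _, _, _, x, hxL, hxN, hxu⟩ := h
  simp only [Real.rpow_one] at hxL hxN hxu
  refine ⟨κ ⊕ Unit, ι ⊕ Unit, inferInstance, inferInstance, inferInstance,
    Sum.elim (fun k => Sum.elim (x k) 0) (fun _ => Sum.elim 0 fun _ => L - N), L, h0, ?_, ?_⟩
  · rintro (k | k) (k' | k') hk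
    · simpa using hxL k k' (by simpa using hk)
    · simp [hxN, abs_sub_comm N, abs_of_nonneg (sub_nonneg.2 hNL)]
    · simp [hxN, abs_of_nonneg (sub_nonneg.2 hNL)]
    · exact absurd rfl hk
  · intro u c hc
    simp only [Real.rpow_one, Fintype.sum_sum_type, Sum.forall, Sum.elim_inl, Sum.elim_inr,
      Pi.zero_apply, zero_sub, abs_neg] at hc
    have h1 := hxu (fun i => u (Sum.inl i)) _ fun k => eq_sub_of_add_eq (hc.1 k)
    have h1' : ∀ i, u (Sum.inl i) = 0 := congrFun h1
    obtain ⟨k⟩ := ‹Nonempty κ›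
    have e1 := hc.1 k
    have e2 := hc.2 ()
    simp only [h1', sub_zero, abs_zero, Finset.sum_const_zero, zero_add, hxN,
      Finset.univ_unique, Finset.sum_singleton] at e1 e2
    have := abs_sub (L - N) (u (Sum.inr default))
    rw [abs_of_nonneg (sub_nonneg.2 hNL)] at this
    change |L - N - u (Sum.inr default)| = c at e2
    linarith

theorem abs_sub_rpow_lt_abs_add_rpow {p a z : ℝ} (hp : 0 < p) (ha : 0 < a) (hz : 0 < z) :
    |a - z| ^ p < |a + z| ^ p := by
  refine Real.rpow_lt_rpow (abs_nonneg _) ?_ hp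
  rw [abs_of_pos (add_pos ha hz), abs_lt]
  constructor <;> linarith

theorem abs_sub_rpow_le_abs_add_rpow {p a z : ℝ} (hp : 0 < p) (ha : 0 ≤ a) (hz : 0 ≤ z) :
    |a - z| ^ p ≤ |a + z| ^ p := by
  refine Real.rpow_le_rpow (abs_nonneg _) ?_ hp.le
  rw [abs_of_nonneg (add_nonneg ha hz), abs_le]
  constructor <;> linarith

theorem eq_zero_of_abs_sub_rpow_eq {p a z : ℝ} (hp : 0 < p) (ha : 0 < a)
    (h : |a - z| ^ p = |a + z| ^ p) : z = 0 := by
  rcases lt_trichotomy z 0 with hz | hz | hz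
  · have := abs_sub_rpow_lt_abs_add_rpow hp ha (neg_pos.2 hz)
    rw [sub_neg_eq_add, ← sub_eq_add_neg] at this
    exact absurd h this.ne'
  · exact hz
  · exact absurd h (abs_sub_rpow_lt_abs_add_rpow hp ha hz).ne

/-- Sylvester's construction of normalized symmetric Hadamard matrices. -/
theorem exists_symmetric_hadamard (m : ℕ) :
    ∃ (ι : Type) (_ : Fintype ι) (o : ι) (H : ι → ι → ℝ), Fintype.card ι = 2 ^ m ∧
      (∀ i j, H i j = 1 ∨ H i j = -1) ∧ (∀ i, H i o = 1) ∧ (∀ i j, H i j = H j i) ∧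
      ∀ i j, i ≠ j → ∑ l, H i l * H j l = 0 := by
  induction m with
  | zero =>
    exact ⟨Unit, inferInstance, (), fun _ _ => 1, by simp, by simp, by simp, by simp,
      fun i j h => absurd rfl h⟩
  | succ m ih =>
    obtain ⟨ι, _, o, H, hcard, hval, ho, hsymm, horth⟩ := ih
    refine ⟨ι × Bool, inferInstance, (o, false),
      fun i j => H i.1 j.1 * bif i.2 && j.2 then -1 else 1, ?_, ?_, ?_, ?_, ?_⟩
    · rw [Fintype.card_prod, hcard, Fintype.card_bool, pow_succ]
    · rintro ⟨i, a⟩ ⟨j, b⟩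
      rcases hval i j with h | h <;> cases a <;> cases b <;> simp [h]
    · rintro ⟨i, a⟩
      simp [ho]
    · rintro ⟨i, a⟩ ⟨j, b⟩
      simp [hsymm i j, Bool.and_comm]
    · rintro ⟨i, a⟩ ⟨j, b⟩ hne
      rw [Fintype.sum_prod_type]
      by_cases hij : i = j
      · subst hij
        refine Finset.sum_eq_zero fun l _ => ?_
        cases a <;> cases b <;> simp_all
      · have key : ∀ s t : ℝ, ∑ l, (H i l * s) * (H j l * t) = 0 := fun s t => by
          have : ∀ l, (H i l * s) * (H j l * t) = (H i l * H j l) * (s * t) := fun l => by ring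
          simp_rw [this, ← Finset.sum_mul, horth i j hij, zero_mul]
        simp only [Fintype.sum_bool, Finset.sum_add_distrib]
        rw [key, key, add_zero]

theorem rigidSimplex_hadamard {p : ℝ} (hp : 1 ≤ p) (m : ℕ) :
    RigidSimplex p (2 ^ p * (2 ^ m / 2)) (2 ^ m - 1) := by
  classical
  obtain ⟨ι, _, o, H, hcard, hval, ho, hsymm, horth⟩ := exists_symmetric_hadamard m
  have hp0 : 0 < p := by linarith
  have hcard' : (Fintype.card ι : ℝ) = 2 ^ m := by rw [hcard]; norm_cast
  refine ⟨ι, {l // l ≠ o}, inferInstance, inferInstance, ⟨o⟩, fun i l => H i l, ?_, ?_, ?_⟩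
  · intro i j hij
    have key : ∀ l, |H i l - H j l| ^ p = 2 ^ p * ((1 - H i l * H j l) / 2) := fun l => by
      rcases hval i l with h | h <;> rcases hval j l with h' | h' <;> rw [h, h'] <;>
        norm_num [hp0.ne']
    have hs := Fintype.sum_eq_add_sum_subtype_ne (fun l => |H i l - H j l| ^ p) o
    rw [ho, ho, sub_self, abs_zero, Real.zero_rpow hp0.ne', zero_add] at hs
    rw [← hs]
    simp_rw [key, ← Finset.mul_sum, ← Finset.sum_div, Finset.sum_sub_distrib, horth i j hij]
    simp [hcard']
  · intro i
    have hs := Fintype.sum_eq_add_sum_subtype_ne (fun l => |H i l| ^ p) o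
    have key : ∀ l, |H i l| ^ p = 1 := fun l => by
      rcases hval i l with h | h <;> simp [h]
    simp only [key] at hs ⊢
    simp only [Finset.sum_const, Finset.card_univ, nsmul_eq_mul, mul_one, hcard'] at hs ⊢
    linarith
  · intro u c hc
    set B : {l // l ≠ o} → ℝ := fun l => (|1 - u l| ^ p - |1 + u l| ^ p) / 2 with hB
    set A : {l // l ≠ o} → ℝ := fun l => (|1 - u l| ^ p + |1 + u l| ^ p) / 2 with hA
    have key : ∀ i (l : {l // l ≠ o}), |H i l - u l| ^ p = A l + H i l * B l := fun i l => by
      simp only [hA, hB]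
      rcases hval i l with h | h <;> rw [h]
      · ring
      · rw [← neg_add', abs_neg]; ring
    simp_rw [key, Finset.sum_add_distrib] at hc
    have hlin : ∀ i, ∑ l : {l // l ≠ o}, H i l * B l = c - ∑ l, A l := fun i => by linarith [hc i]
    have hcol : ∀ l : {l // l ≠ o}, ∑ i, H i l = 0 := fun l => by
      have := horth l o l.2
      simp_rw [hsymm o, ho, mul_one, hsymm l] at this
      exact this
    funext n
    have h0 : (2 : ℝ) ^ m * B n = 0 := by
      have e1 : ∑ i, H i n * ∑ l : {l // l ≠ o}, H i l * B l = 0 := by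
        simp_rw [hlin, ← Finset.sum_mul, hcol, zero_mul]
      simp_rw [Finset.mul_sum] at e1
      rw [Finset.sum_comm, Finset.sum_eq_single n] at e1
      · rw [← e1, ← hcard']
        have : ∀ i, H i n * (H i n * B n) = B n := fun i => by
          rcases hval i n with h | h <;> rw [h] <;> ring
        simp [this]
      · intro l _ hl
        simp_rw [← mul_assoc, ← Finset.sum_mul, hsymm _ n.1, hsymm _ l.1,
          horth n l fun h => hl (Subtype.ext h.symm), zero_mul]
      · simp
    have hBn : B n = 0 := (mul_eq_zero.1 h0).resolve_left (by positivity)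
    refine eq_zero_of_abs_sub_rpow_eq hp0 one_pos ?_
    simp only [hB] at hBn
    linarith

theorem one_add_rpow_add_one_sub_rpow_lt {p b : ℝ} (hp : 1 < p) (h0 : 0 ≤ b) (h1 : b ≤ 1) :
    (1 + b) ^ p + (1 - b) ^ p < 2 ^ p * (1 + b ^ p) := by
  have hbp : 0 ≤ b ^ p := Real.rpow_nonneg h0 p
  have e1 : (1 + b) ^ p ≤ 2 ^ (p - 1) * (1 + b ^ p) := by
    lift b to NNReal using h0
    have := NNReal.rpow_add_le_mul_rpow_add_rpow 1 b hp.le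
    rw [NNReal.one_rpow] at this
    exact_mod_cast this
  have e2 : (1 - b) ^ p ≤ 1 := Real.rpow_le_one (by linarith) (by linarith) (by linarith)
  have e3 : (2 : ℝ) ^ p = 2 ^ (p - 1) * 2 := by
    rw [← Real.rpow_add_one (by norm_num)]; ring_nf
  have e4 : (1 : ℝ) < 2 ^ (p - 1) := Real.one_lt_rpow (by norm_num) (by linarith)
  rw [e3]
  nlinarith

/-- The four points `(α, ±(1, b))`, `(-α, ±(b, -1))` of `ℓ_p^3`. -/
theorem rigidSimplex_four_points {p b : ℝ} (hp : 1 < p) (h0 : 0 ≤ b) (h1 : b ≤ 1) :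
    RigidSimplex p (2 ^ p * (1 + b ^ p))
      (2 * (1 + b ^ p) - ((1 + b) ^ p + (1 - b) ^ p) / 2 ^ p) := by
  have hp0 : 0 < p := by linarith
  have h2 : (0 : ℝ) < 2 ^ p := by positivity
  set a : ℝ := 1 + b ^ p - ((1 + b) ^ p + (1 - b) ^ p) / 2 ^ p with ha
  have ha0 : 0 < a := by
    rw [ha, sub_pos, div_lt_iff₀ h2, mul_comm]
    exact one_add_rpow_add_one_sub_rpow_lt hp h0 h1
  set α : ℝ := a ^ p⁻¹ with hα
  have hα0 : 0 < α := Real.rpow_pos_of_pos ha0 _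
  have hαp : α ^ p = a := Real.rpow_inv_rpow ha0.le hp0.ne'
  have h2a : (2 * α) ^ p = 2 ^ p * (1 + b ^ p) - ((1 + b) ^ p + (1 - b) ^ p) := by
    rw [Real.mul_rpow (by norm_num) hα0.le, hαp, ha]
    field_simp
  have h2b : (2 * b) ^ p = 2 ^ p * b ^ p := Real.mul_rpow (by norm_num) h0
  have a1 : |1 + b| = 1 + b := abs_of_nonneg (by linarith)
  have a2 : |1 - b| = 1 - b := abs_of_nonneg (by linarith)
  have a3 : |2 * α| = 2 * α := abs_of_nonneg (by linarith)
  have a4 : |2 * b| = 2 * b := abs_of_nonneg (by linarith)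
  refine ⟨Fin 4, Fin 3, inferInstance, inferInstance, inferInstance,
    ![![α, 1, b], ![α, -1, -b], ![-α, b, -1], ![-α, -b, 1]], ?_, ?_, ?_⟩
  · have key : ∀ x y z : ℝ, |x| = 2 * α → (|y| = 1 + b ∧ |z| = 1 - b ∨ |y| = 1 - b ∧ |z| = 1 + b) →
        |x| ^ p + |y| ^ p + |z| ^ p = 2 ^ p * (1 + b ^ p) := by
      rintro x y z hx (⟨hy, hz⟩ | ⟨hy, hz⟩) <;> rw [hx, hy, hz, h2a] <;> ring
    have key' : ∀ x y z : ℝ, |x| = 0 → (|y| = 2 ∧ |z| = 2 * b ∨ |y| = 2 * b ∧ |z| = 2) →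
        |x| ^ p + |y| ^ p + |z| ^ p = 2 ^ p * (1 + b ^ p) := by
      rintro x y z hx (⟨hy, hz⟩ | ⟨hy, hz⟩) <;> rw [hx, hy, hz, h2b, Real.zero_rpow hp0.ne'] <;> ring
    set x : Fin 4 → Fin 3 → ℝ :=
      ![![α, 1, b], ![α, -1, -b], ![-α, b, -1], ![-α, -b, 1]] with hx
    have main : ∀ k k', k < k' → ∑ i, |x k i - x k' i| ^ p = 2 ^ p * (1 + b ^ p) := by
      have e01 : |α - α| ^ p + |1 - -1| ^ p + |b - -b| ^ p = 2 ^ p * (1 + b ^ p) :=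
        key' _ _ _ (by simp) (Or.inl ⟨by norm_num, by rw [← a4]; congr 1; ring⟩)
      have e23 : |-α - -α| ^ p + |b - -b| ^ p + |-1 - 1| ^ p = 2 ^ p * (1 + b ^ p) :=
        key' _ _ _ (by simp) (Or.inr ⟨by rw [← a4]; congr 1; ring, by norm_num⟩)
      have hαα : |α - -α| = 2 * α := by rw [← a3]; congr 1; ring
      have e02 : |α - -α| ^ p + |1 - b| ^ p + |b - -1| ^ p = 2 ^ p * (1 + b ^ p) :=
        key _ _ _ hαα (Or.inr ⟨a2, by rw [← a1]; congr 1; ring⟩)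
      have e03 : |α - -α| ^ p + |1 - -b| ^ p + |b - 1| ^ p = 2 ^ p * (1 + b ^ p) :=
        key _ _ _ hαα (Or.inl ⟨by rw [← a1]; congr 1; ring, by rw [abs_sub_comm, a2]⟩)
      have e12 : |α - -α| ^ p + |-1 - b| ^ p + |-b - -1| ^ p = 2 ^ p * (1 + b ^ p) :=
        key _ _ _ hαα (Or.inl ⟨by rw [← a1, ← abs_neg]; congr 1; ring, by rw [← a2]; congr 1; ring⟩)
      have e13 : |α - -α| ^ p + |-1 - -b| ^ p + |-b - 1| ^ p = 2 ^ p * (1 + b ^ p) :=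
        key _ _ _ hαα (Or.inr ⟨by rw [← a2, ← abs_neg]; congr 1; ring,
          by rw [← a1, ← abs_neg]; congr 1; ring⟩)
      intro k k' hk
      rw [Fin.sum_univ_three]
      fin_cases k <;> fin_cases k' <;> try exact absurd hk (by decide)
      exacts [e01, e02, e03, e12, e13, e23]
    intro k k' hk
    rcases lt_or_gt_of_ne hk with h | h
    · exact main k k' h
    · simp_rw [abs_sub_comm (x k _)]
      exact main k' k h
  · have : α ^ p + 1 + b ^ p = 2 * (1 + b ^ p) - ((1 + b) ^ p + (1 - b) ^ p) / 2 ^ p := by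
      rw [hαp, ha]; ring
    intro k
    rw [← this]
    fin_cases k <;>
      simp [Fin.sum_univ_three, abs_of_pos hα0, abs_of_nonneg h0, add_right_comm]
  · intro u c hc
    have c0 := hc 0
    have c1 := hc 1
    have c2 := hc 2
    have c3 := hc 3
    simp only [Fin.sum_univ_three, Matrix.cons_val] at c0 c1 c2 c3
    have hneg : ∀ x y : ℝ, |-x - y| = |x + y| := fun x y => by rw [← neg_add', abs_neg]
    simp only [hneg] at c0 c1 c2 c3
    have nonneg : ∀ {x z : ℝ}, 0 ≤ x → z ≤ 0 → |x + z| ^ p ≤ |x - z| ^ p := fun hx hz => by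
      simpa [sub_eq_add_neg] using abs_sub_rpow_le_abs_add_rpow hp0 hx (neg_nonneg.2 hz)
    have pos : ∀ {x z : ℝ}, 0 < x → z < 0 → |x + z| ^ p < |x - z| ^ p := fun hx hz => by
      simpa [sub_eq_add_neg] using abs_sub_rpow_lt_abs_add_rpow hp0 hx (neg_pos.2 hz)
    have u1 : u 1 = 0 := by
      rcases lt_trichotomy (u 1) 0 with h | h | h
      · have l1 := pos one_pos h
        have l2 := nonneg h0 h.le
        rcases lt_or_ge 0 (u 2) with h' | h'
        · have := abs_sub_rpow_lt_abs_add_rpow hp0 one_pos h'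
          linarith
        · have := nonneg h0 h'
          linarith
      · exact h
      · have l1 := abs_sub_rpow_lt_abs_add_rpow hp0 one_pos h
        have l2 := abs_sub_rpow_le_abs_add_rpow hp0 h0 h.le
        rcases lt_or_ge (u 2) 0 with h' | h'
        · have := pos one_pos h'
          linarith
        · have := abs_sub_rpow_le_abs_add_rpow hp0 h0 h'
          linarith
    have u2 : u 2 = 0 := by
      refine eq_zero_of_abs_sub_rpow_eq hp0 one_pos ?_
      rw [u1] at c2 c3
      simp only [sub_zero, add_zero] at c2 c3
      linarith
    have u0 : u 0 = 0 := by
      refine eq_zero_of_abs_sub_rpow_eq hp0 hα0 ?_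
      rw [u1, u2] at c0 c2
      simp only [sub_zero, add_zero, abs_one] at c0 c2
      linarith
    funext i
    fin_cases i
    · exact u0
    · exact u1
    · exact u2

theorem exists_rigidSimplex_neg {p : ℝ} (hp1 : 1 ≤ p) (hp2 : p < 2) :
    ∃ δ : ℝ, 0 < δ ∧ δ ≤ 1 ∧ RigidSimplex p 1 ((1 - -δ) / 2) := by
  have h4 : (2 : ℝ) ^ p < 4 := by
    have : (2 : ℝ) ^ p < 2 ^ (2 : ℝ) := Real.rpow_lt_rpow_of_exponent_lt (by norm_num) hp2
    norm_num at this
    exact this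
  have h2 : (2 : ℝ) ≤ 2 ^ p := by
    simpa using Real.rpow_le_rpow_of_exponent_le (by norm_num : (1 : ℝ) ≤ 2) hp1
  obtain ⟨m, hm⟩ := exists_pow_lt_of_lt_one (y := (1 / 2 : ℝ)) (x := 1 - 2 ^ p / 4)
    (by linarith) (by norm_num)
  have hs := (rigidSimplex_hadamard hp1 m).normalize hp1 (by positivity)
  have hm0 : (0 : ℝ) < (1 / 2) ^ m := by positivity
  have hmm : (1 / 2 : ℝ) ^ m * 2 ^ m = 1 := by rw [← mul_pow]; norm_num
  refine ⟨4 * (1 - (1 / 2) ^ m) / 2 ^ p - 1, ?_, ?_, ?_⟩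
  · rw [sub_pos, one_lt_div (by positivity)]
    linarith
  · rw [sub_le_iff_le_add, div_le_iff₀ (by positivity)]
    linarith
  · convert hs using 1
    field_simp
    linear_combination (-4 : ℝ) * hmm

theorem exists_rigidSimplex_interval {p : ℝ} (hp1 : 1 < p) (hp2 : p < 2) :
    ∃ Y₀ Y₁ : ℝ, Y₀ < Y₁ ∧ 0 < Y₁ ∧
      ∀ Y ∈ Set.Icc Y₀ Y₁, RigidSimplex p 1 ((1 - Y) / 2) := by
  have hp0 : 0 < p := by linarith
  have h4 : (2 : ℝ) ^ p < 4 := by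
    have : (2 : ℝ) ^ p < 2 ^ (2 : ℝ) := Real.rpow_lt_rpow_of_exponent_lt (by norm_num) hp2
    norm_num at this
    exact this
  have h2 : (2 : ℝ) < 2 ^ p := by
    simpa using Real.rpow_lt_rpow_of_exponent_lt (by norm_num : (1 : ℝ) < 2) hp1
  set f : ℝ → ℝ := fun b => 1 - 2 * ((2 * (1 + b ^ p) - ((1 + b) ^ p + (1 - b) ^ p) / 2 ^ p) /
    (2 ^ p * (1 + b ^ p))) with hf
  have hcont : ContinuousOn f (Set.Icc 0 1) := by
    have c : Continuous fun b : ℝ => b ^ p := Real.continuous_rpow_const hp0.le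
    have c1 : Continuous fun b : ℝ => (1 + b) ^ p := c.comp (by fun_prop)
    have c2 : Continuous fun b : ℝ => (1 - b) ^ p := c.comp (by fun_prop)
    refine continuousOn_const.sub (continuousOn_const.mul (ContinuousOn.div ?_ ?_ ?_))
    · fun_prop
    · fun_prop
    · intro b hb
      have := Real.rpow_nonneg hb.1 p
      positivity
  have f0 : f 0 = (1 - 2 / 2 ^ p) ^ 2 := by
    simp only [hf, Real.zero_rpow hp0.ne', add_zero, sub_zero, Real.one_rpow]
    field_simp
    ring
  have f1 : f 1 = 1 - 3 / 2 ^ p := by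
    simp only [hf, Real.one_rpow, sub_self, Real.zero_rpow hp0.ne', one_add_one_eq_two, add_zero]
    field_simp
    ring
  refine ⟨f 1, f 0, ?_, ?_, fun Y hY => ?_⟩
  · rw [f0, f1, ← sub_pos]
    have : (1 - 2 / 2 ^ p) ^ 2 - (1 - 3 / 2 ^ p) = (4 - 2 ^ p) / ((2 : ℝ) ^ p) ^ 2 := by
      field_simp
      ring
    rw [this]
    exact div_pos (by linarith) (by positivity)
  · rw [f0]
    refine pow_pos (sub_pos.2 ?_) 2
    rwa [div_lt_one (by positivity)]
  · obtain ⟨b, hb, rfl⟩ := intermediate_value_Icc' zero_le_one hcont hY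
    have hbp := Real.rpow_nonneg hb.1 p
    convert (rigidSimplex_four_points hp1 hb.1 hb.2).normalize hp1.le (by positivity) using 1
    simp only [hf]
    ring

theorem hasCenterlessSimplex {p : ℝ} (hp1 : 1 ≤ p) (hp2 : p < 2) : HasCenterlessSimplex p := by
  rcases hp1.eq_or_lt with rfl | hp
  · have h := rigidSimplex_hadamard le_rfl 2
    exact HasCenterlessSimplex.of_rigid_one h (by norm_num) (by norm_num) (by norm_num)
  obtain ⟨δ, hδ0, hδ1, hδ⟩ := exists_rigidSimplex_neg hp1 hp2
  obtain ⟨Y₀, Y₁, hlt, hY₁, hY⟩ := exists_rigidSimplex_interval hp hp2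
  have hlim : Filter.Tendsto (fun n : ℕ => Y₁ * δ ^ ((n : ℝ)⁻¹)) Filter.atTop (nhds Y₁) := by
    have h0 : Filter.Tendsto (fun n : ℕ => (n : ℝ)⁻¹) Filter.atTop (nhds 0) :=
      tendsto_inv_atTop_nhds_zero_nat
    simpa using (((Real.continuous_const_rpow hδ0.ne').tendsto 0).comp h0).const_mul Y₁
  obtain ⟨n, hn, hn0⟩ := ((hlim.eventually (lt_mem_nhds hlt)).and
    (Filter.eventually_ne_atTop 0)).exists
  set Y := Y₁ * δ ^ ((n : ℝ)⁻¹) with hYdef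
  have hYpos : 0 < Y := by positivity
  have hYle : Y ≤ Y₁ := mul_le_of_le_one_right hY₁.le (Real.rpow_le_one hδ0.le hδ1 (by positivity))
  have hYn : Y ^ n = δ * Y₁ ^ n := by
    rw [hYdef, mul_pow, Real.rpow_inv_natCast_pow hδ0.le hn0, mul_comm]
  have hpos := (hY Y ⟨hn.le, hYle⟩).pow hp1 hYpos hn0
  have hneg := hδ.mul_pow hp1 hY₁ (hY Y₁ ⟨hlt.le, le_rfl⟩) n
  rw [hYn] at hpos
  have : 0 < δ * Y₁ ^ n := by positivity
  exact HasCenterlessSimplex.of_rigid hp1 hpos hneg (by ring) (by intro h; linarith)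

theorem maximalEquilateral_range {E κ : Type*} [NormedAddCommGroup E] [Nonempty κ]
    {a : κ → E} {lam : ℝ} (hlam : 0 < lam) (ha : ∀ k k', k ≠ k' → ‖a k - a k'‖ = lam)
    (hcenter : ∀ (z : E) (μ : ℝ), ¬ ∀ k, ‖a k - z‖ = μ) :
    MaximalEquilateral (Set.range a) := by
  refine ⟨⟨lam, hlam, ?_⟩, ?_⟩
  · rintro _ ⟨k, rfl⟩ _ ⟨k', rfl⟩ hne
    exact ha k k' fun h => hne (by rw [h])
  · rintro B ⟨μ, -, hB⟩ hsub
    refine Set.Subset.antisymm (fun z hz => ?_) hsub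
    by_contra hzA
    exact hcenter z μ fun k => hB (hsub ⟨k, rfl⟩) hz fun h => hzA ⟨k, h⟩

theorem ncard_range_le {E κ : Type*} [Fintype κ] (a : κ → E) :
    (Set.range a).ncard ≤ Fintype.card κ := by
  rw [← Set.image_univ, ← Nat.card_eq_fintype_card, ← Set.ncard_univ]
  exact Set.ncard_image_le Set.finite_univ

theorem norm_toLp_rpow {p : ℝ} [Fact (1 ≤ ENNReal.ofReal p)] (hp : 1 ≤ p) {ι : Type*} [Fintype ι]
    (x : PiLp (ENNReal.ofReal p) fun _ : ι => ℝ) : ‖x‖ ^ p = ∑ i, |x i| ^ p := by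
  have hp0 : 0 < p := by linarith
  have ht : (ENNReal.ofReal p).toReal = p := ENNReal.toReal_ofReal hp0.le
  rw [PiLp.norm_eq_sum (by rwa [ht]), ht, ← Real.rpow_mul (by positivity),
    one_div_mul_cancel hp0.ne', Real.rpow_one]
  simp

/-- A centerless simplex embeds in `ℓ_p^d` for every large `d`, and remains centerless. -/
theorem HasCenterlessSimplex.exists_piLp {p : ℝ} [Fact (1 ≤ ENNReal.ofReal p)] (hp : 1 ≤ p)
    (h : HasCenterlessSimplex p) :
    ∃ (κ : Type) (_ : Fintype κ) (_ : Nonempty κ) (d₀ : ℕ), ∀ d, d₀ ≤ d →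
      ∃ (a : κ → PiLp (ENNReal.ofReal p) fun _ : Fin d => ℝ) (lam : ℝ), 0 < lam ∧
        (∀ k k', k ≠ k' → ‖a k - a k'‖ = lam) ∧
        ∀ z (μ : ℝ), ¬ ∀ k, ‖a k - z‖ = μ := by
  classical
  obtain ⟨κ, ι, _, _, hκ, x, L, hL0, hL, hx⟩ := h
  have hp0 : 0 < p := by linarith
  refine ⟨κ, inferInstance, hκ, Fintype.card ι, fun d hd => ?_⟩
  obtain ⟨f⟩ : Nonempty (ι ↪ Fin d) :=
    Function.Embedding.nonempty_of_card_le (by simpa using hd)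
  set a : κ → PiLp (ENNReal.ofReal p) fun _ : Fin d => ℝ :=
    fun k => WithLp.toLp _ (Function.extend f (x k) 0) with ha
  have split : ∀ g : Fin d → ℝ,
      ∑ j, g j = ∑ i, g (f i) + ∑ j ∈ (Finset.univ.map f)ᶜ, g j := fun g => by
    rw [← Finset.sum_add_sum_compl (Finset.univ.map f), Finset.sum_map]
  have hin : ∀ k i, a k (f i) = x k i := fun k i => f.injective.extend_apply _ _ _
  have hout : ∀ k, ∀ j ∈ (Finset.univ.map f)ᶜ, a k j = 0 := fun k j hj =>
    Function.extend_apply' _ _ _ fun ⟨i, hi⟩ => by simp [← hi] at hj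
  have hdist : ∀ k z, ‖a k - z‖ ^ p = ∑ i, |x k i - z (f i)| ^ p +
      ∑ j ∈ (Finset.univ.map f)ᶜ, |z j| ^ p := fun k z => by
    rw [norm_toLp_rpow hp, split]
    congr 1
    · simp [hin]
    · exact Finset.sum_congr rfl fun j hj => by simp [hout k j hj]
  refine ⟨a, L ^ p⁻¹, by positivity, fun k k' hk => ?_, fun z μ hz => ?_⟩
  · have h0 : ∑ j ∈ (Finset.univ.map f)ᶜ, |a k' j| ^ p = 0 :=
      Finset.sum_eq_zero fun j hj => by simp [hout k' j hj, hp0.ne']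
    have e := hdist k (a k')
    simp_rw [h0, hin, hL k k' hk, add_zero] at e
    rw [← e, Real.rpow_rpow_inv (norm_nonneg _) hp0.ne']
  · refine hx (fun i => z (f i)) (μ ^ p - ∑ j ∈ (Finset.univ.map f)ᶜ, |z j| ^ p) fun k => ?_
    rw [← hz k, hdist, add_sub_cancel_right]

theorem prod_norm_rpow {q : ℝ} [Fact (1 ≤ ENNReal.ofReal q)] (hq : 1 ≤ q) {E X : Type*}
    [NormedAddCommGroup E] [NormedAddCommGroup X] (w : WithLp (ENNReal.ofReal q) (E × X)) :
    ‖w‖ ^ q = ‖w.fst‖ ^ q + ‖w.snd‖ ^ q := by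
  have hq0 : 0 < q := by linarith
  have ht : (ENNReal.ofReal q).toReal = q := ENNReal.toReal_ofReal hq0.le
  rw [WithLp.prod_norm_eq_add (by rwa [ht]), ht, ← Real.rpow_mul (by positivity),
    one_div_mul_cancel hq0.ne', Real.rpow_one]

theorem centerless_prod {q : ℝ} [Fact (1 ≤ ENNReal.ofReal q)] (hq : 1 ≤ q) {E X κ : Type*}
    [NormedAddCommGroup E] [NormedAddCommGroup X] {a : κ → E}
    (hcenter : ∀ (z : E) (μ : ℝ), ¬ ∀ k, ‖a k - z‖ = μ) (w : WithLp (ENNReal.ofReal q) (E × X))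
    (μ : ℝ) : ¬ ∀ k, ‖WithLp.toLp (ENNReal.ofReal q) (a k, (0 : X)) - w‖ = μ := by
  intro h
  have hq0 : q ≠ 0 := by positivity
  refine hcenter w.fst ((μ ^ q - ‖w.snd‖ ^ q) ^ q⁻¹) fun k => ?_
  have e := prod_norm_rpow hq (WithLp.toLp (ENNReal.ofReal q) (a k, (0 : X)) - w)
  rw [h k] at e
  simp only [WithLp.sub_fst, WithLp.sub_snd, WithLp.toLp_fst, WithLp.toLp_snd, zero_sub,
    norm_neg] at e
  rw [e, add_sub_cancel_right, Real.rpow_rpow_inv (norm_nonneg _) hq0]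

/-- For each `p ∈ [1,2)` there exist `C, d₀ ∈ ℕ` such that for every
`d ≥ d₀`, every normed space `X`, and every `q ∈ [1,∞)`, `m(ℓ_p^d ⊕_q X) ≤ C`; in
particular `m(ℓ_p^d) ≤ C` for all `d ≥ d₀`. -/
theorem statement17 (p : ℝ) (hp1 : 1 ≤ p) (hp2 : p < 2) :
    ∃ C d₀ : ℕ, ∀ d : ℕ, d₀ ≤ d →
      letI : Fact (1 ≤ ENNReal.ofReal p) := ⟨ENNReal.one_le_ofReal.mpr hp1⟩
      (∀ (X : Type) [NormedAddCommGroup X] [NormedSpace ℝ X] (q : ℝ), ∀ _hq : 1 ≤ q,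
        letI : Fact (1 ≤ ENNReal.ofReal q) := ⟨ENNReal.one_le_ofReal.mpr _hq⟩
        ∃ A : Set (WithLp (ENNReal.ofReal q)
            ((PiLp (ENNReal.ofReal p) fun _ : Fin d => ℝ) × X)),
          MaximalEquilateral A ∧ A.Finite ∧ A.ncard ≤ C) ∧
      ∃ A : Set (PiLp (ENNReal.ofReal p) fun _ : Fin d => ℝ),
        MaximalEquilateral A ∧ A.Finite ∧ A.ncard ≤ C := by
  have : Fact (1 ≤ ENNReal.ofReal p) := ⟨ENNReal.one_le_ofReal.mpr hp1⟩
  obtain ⟨κ, _, _, d₀, h⟩ := (hasCenterlessSimplex hp1 hp2).exists_piLp hp1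
  refine ⟨Fintype.card κ, d₀, fun d hd => ?_⟩
  obtain ⟨a, lam, hlam, ha, hcenter⟩ := h d hd
  refine ⟨fun X _ _ q hq => ?_, Set.range a, maximalEquilateral_range hlam ha hcenter,
    Set.finite_range a, ncard_range_le a⟩
  have : Fact (1 ≤ ENNReal.ofReal q) := ⟨ENNReal.one_le_ofReal.mpr hq⟩
  exact ⟨Set.range fun k => WithLp.toLp (ENNReal.ofReal q) (a k, (0 : X)),
    maximalEquilateral_range hlam (fun k k' hk => by
      rw [← dist_eq_norm, WithLp.dist_toLp_fst, dist_eq_norm, ha k k' hk])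
      (centerless_prod hq hcenter), Set.finite_range _, ncard_range_le _⟩
end

section
/- For each p ∈ [1,2) there exists a constant C = C(p) ∈ ℕ such that for every set Γ, the space ℓ_p(Γ) contains a maximal equilateral set of cardinality at most C; that is, m(ℓ_p(Γ)) ≤ C, with C depending only on p and not on Γ. -/
open MeasureTheory in
theorem integrableOn_one_sub_cos_mul_rpow {p : ℝ} (hp0 : 0 < p) (hp2 : p < 2) (x : ℝ) :
    IntegrableOn (fun t : ℝ => (1 - Real.cos (t * x)) * t ^ (-1 - p)) (Set.Ioi 0) := by
  have hmeas : Measurable fun t : ℝ => (1 - Real.cos (t * x)) * t ^ (-1 - p) := by fun_prop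
  rw [← Set.Ioc_union_Ioi_eq_Ioi zero_le_one]
  refine IntegrableOn.union ?_ ?_
  · have h : IntegrableOn (fun t : ℝ => x ^ 2 / 2 * t ^ (1 - p)) (Set.Ioc 0 1) :=
      (((intervalIntegral.intervalIntegrable_rpow' (by linarith)).1).const_mul _)
    refine Integrable.mono' h hmeas.aestronglyMeasurable ?_
    refine (ae_restrict_iff' measurableSet_Ioc).2 (Filter.Eventually.of_forall fun t ht => ?_)
    have ht0 : 0 < t := ht.1
    have h1 : 0 ≤ 1 - Real.cos (t * x) := by linarith [Real.cos_le_one (t * x)]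
    have h2 := Real.one_sub_sq_div_two_le_cos (x := t * x)
    have h3 : t ^ (1 - p) = t ^ 2 * t ^ (-1 - p) := by
      rw [← Real.rpow_natCast, ← Real.rpow_add ht0]; norm_num; ring_nf
    rw [Real.norm_of_nonneg (by positivity), h3]
    have := mul_le_mul_of_nonneg_right (show 1 - Real.cos (t * x) ≤ x ^ 2 / 2 * t ^ 2 by linarith)
      (Real.rpow_nonneg ht0.le (-1 - p))
    linarith
  · have h : IntegrableOn (fun t : ℝ => 2 * t ^ (-1 - p)) (Set.Ioi 1) :=
      (integrableOn_Ioi_rpow_of_lt (by linarith) one_pos).const_mul _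
    refine Integrable.mono' h hmeas.aestronglyMeasurable ?_
    refine (ae_restrict_iff' measurableSet_Ioi).2 (Filter.Eventually.of_forall fun t ht => ?_)
    have ht0 : 0 < t := zero_lt_one.trans ht
    have h1 : 0 ≤ 1 - Real.cos (t * x) := by linarith [Real.cos_le_one (t * x)]
    rw [Real.norm_of_nonneg (by positivity)]
    gcongr
    linarith [Real.neg_one_le_cos (t * x)]

open MeasureTheory in
theorem integral_one_sub_cos_mul_rpow {p : ℝ} (hp0 : 0 < p) (x : ℝ) :
    ∫ t in Set.Ioi (0 : ℝ), (1 - Real.cos (t * x)) * t ^ (-1 - p) =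
      |x| ^ p * ∫ t in Set.Ioi (0 : ℝ), (1 - Real.cos t) * t ^ (-1 - p) := by
  rcases eq_or_ne x 0 with rfl | hx
  · simp [Real.zero_rpow hp0.ne']
  have hx' : 0 < |x| := abs_pos.2 hx
  have key := integral_comp_mul_left_Ioi (fun t : ℝ => (1 - Real.cos t) * t ^ (-1 - p)) 0 hx'
  rw [mul_zero, smul_eq_mul] at key
  have h : ∫ t in Set.Ioi (0 : ℝ), (1 - Real.cos (t * x)) * t ^ (-1 - p) =
      ∫ t in Set.Ioi (0 : ℝ), |x| ^ (1 + p) *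
        ((1 - Real.cos (|x| * t)) * (|x| * t) ^ (-1 - p)) := by
    refine setIntegral_congr_fun measurableSet_Ioi fun t ht => ?_
    have ht0 : 0 < t := ht
    have hcos : Real.cos (|x| * t) = Real.cos (t * x) := by
      rw [← Real.cos_abs (t * x), abs_mul, abs_of_pos ht0, mul_comm]
    have hpow : |x| ^ (1 + p) * |x| ^ (-1 - p) = 1 := by
      rw [← Real.rpow_add hx']; ring_nf; exact Real.rpow_zero _
    simp only [hcos]
    rw [Real.mul_rpow hx'.le ht0.le]
    linear_combination (-(1 - Real.cos (t * x)) * t ^ (-1 - p)) * hpow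
  rw [h, integral_const_mul, key, ← mul_assoc, Real.rpow_add hx', Real.rpow_one]
  congr 1
  field_simp

open MeasureTheory in
theorem integral_one_sub_cos_mul_rpow_pos {p : ℝ} (hp0 : 0 < p) (hp2 : p < 2) :
    0 < ∫ t in Set.Ioi (0 : ℝ), (1 - Real.cos t) * t ^ (-1 - p) := by
  have hint := integrableOn_one_sub_cos_mul_rpow hp0 hp2 1
  simp only [mul_one] at hint
  rw [setIntegral_pos_iff_support_of_nonneg_ae _ hint]
  · refine lt_of_lt_of_le ?_ (measure_mono (s := Set.Ioo 0 1) fun t ht => ⟨?_, ht.1⟩)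
    · simp
    · have h1 : Real.cos t < 1 := by
        have := Real.cos_lt_cos_of_nonneg_of_le_pi (le_refl 0)
          (by linarith [ht.2, Real.pi_gt_three]) ht.1
        rwa [Real.cos_zero] at this
      exact mul_ne_zero (by linarith) (Real.rpow_pos_of_pos ht.1 _).ne'
  · refine (ae_restrict_iff' measurableSet_Ioi).2 (Filter.Eventually.of_forall fun t ht => ?_)
    exact mul_nonneg (by linarith [Real.cos_le_one t]) (Real.rpow_nonneg (le_of_lt ht) _)

theorem sum_sum_one_sub_cos_sub_le {ι : Type*} (s : Finset ι) (a : ι → ℝ) :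
    ∑ i ∈ s, ∑ j ∈ s, (1 - Real.cos (a i - a j)) ≤ 2 * s.card * ∑ i ∈ s, (1 - Real.cos (a i)) := by
  simp only [Real.cos_sub, Finset.sum_sub_distrib, Finset.sum_add_distrib, ← Finset.sum_mul_sum,
    Finset.sum_const, nsmul_eq_mul, mul_one]
  nlinarith [sq_nonneg ((s.card : ℝ) - ∑ i ∈ s, Real.cos (a i)),
    sq_nonneg (∑ i ∈ s, Real.sin (a i))]

/-- The function `|x| ^ p` is of negative type for `0 < p < 2`; this is the inequality
obtained from equal weights and one extra point at the origin. -/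
theorem sum_sum_abs_sub_rpow_le {p : ℝ} (hp0 : 0 < p) (hp2 : p < 2) {ι : Type*} (s : Finset ι)
    (a : ι → ℝ) :
    ∑ i ∈ s, ∑ j ∈ s, |a i - a j| ^ p ≤ 2 * s.card * ∑ i ∈ s, |a i| ^ p := by
  have hint := integrableOn_one_sub_cos_mul_rpow hp0 hp2
  refine le_of_mul_le_mul_right ?_ (integral_one_sub_cos_mul_rpow_pos hp0 hp2)
  simp only [Finset.sum_mul, mul_assoc, ← integral_one_sub_cos_mul_rpow hp0]
  simp only [← mul_assoc]
  rw [← MeasureTheory.integral_finsetSum _ fun i _ => hint (a i)]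
  simp_rw [← MeasureTheory.integral_finsetSum s fun j _ => hint (a _ - a j)]
  rw [← MeasureTheory.integral_finsetSum _ fun i _ =>
      MeasureTheory.integrable_finsetSum _ fun j _ => hint (a i - a j),
    ← MeasureTheory.integral_const_mul]
  refine MeasureTheory.setIntegral_mono_on
    (MeasureTheory.integrable_finsetSum _ fun i _ =>
      MeasureTheory.integrable_finsetSum _ fun j _ => hint (a i - a j))
    ((MeasureTheory.integrable_finsetSum _ fun i _ => hint (a i)).const_mul _)
    measurableSet_Ioi fun t ht => ?_
  have h := mul_le_mul_of_nonneg_right (sum_sum_one_sub_cos_sub_le s fun i => t * a i)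
    (Real.rpow_nonneg (le_of_lt ht) (-1 - p))
  simpa only [Finset.sum_mul, mul_assoc, mul_sub] using h

theorem Equilateral.subset {E : Type*} [NormedAddCommGroup E] {A B : Set E} (hB : Equilateral B)
    (h : A ⊆ B) : Equilateral A :=
  let ⟨lam, hlam, hpair⟩ := hB
  ⟨lam, hlam, hpair.mono h⟩

theorem exists_maximalEquilateral_of_card_le {E : Type*} [NormedAddCommGroup E] {A : Finset E}
    {C : ℕ} (hA : Equilateral (A : Set E))
    (hC : ∀ B : Finset E, A ⊆ B → Equilateral (B : Set E) → B.card ≤ C) :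
    ∃ M : Set E, MaximalEquilateral M ∧ M.Finite ∧ M.ncard ≤ C := by
  classical
  let P : ℕ → Prop := fun k => ∃ B : Finset E, A ⊆ B ∧ Equilateral (B : Set E) ∧ B.card = k
  obtain ⟨B, hAB, hB, hcard⟩ : P (Nat.findGreatest P C) :=
    Nat.findGreatest_spec (hC A subset_rfl hA) ⟨A, subset_rfl, hA, rfl⟩
  refine ⟨B, ⟨hB, fun D hD hBD => (hBD.antisymm fun x hx => ?_).symm⟩, B.finite_toSet, ?_⟩
  · by_contra hxB
    have hins : Equilateral ((insert x B : Finset E) : Set E) :=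
      hD.subset (by rw [Finset.coe_insert]; exact Set.insert_subset hx hBD)
    have hle := hC _ (hAB.trans (Finset.subset_insert x B)) hins
    have := Nat.le_findGreatest (P := P) hle
      ⟨_, hAB.trans (Finset.subset_insert x B), hins, rfl⟩
    rw [Finset.card_insert_of_notMem hxB] at this
    omega
  · rw [Set.ncard_coe_finset]
    exact hC B hAB hB

theorem Equilateral.card_le_five_pow_finrank {E : Type*} [NormedAddCommGroup E] [NormedSpace ℝ E]
    [FiniteDimensional ℝ E] {B : Finset E} (hB : Equilateral (B : Set E)) :
    B.card ≤ 5 ^ Module.finrank ℝ E := by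
  classical
  obtain ⟨lam, hlam, hpair⟩ := hB
  rcases B.eq_empty_or_nonempty with rfl | ⟨b, hb⟩
  · simp
  have hinj : Function.Injective fun x : E => lam⁻¹ • (x - b) := fun x y hxy =>
    sub_left_injective (smul_right_injective E (inv_ne_zero hlam.ne') hxy)
  have hnorm : ∀ z : E, ‖lam⁻¹ • z‖ = lam⁻¹ * ‖z‖ := fun z => by
    rw [norm_smul, Real.norm_of_nonneg (inv_nonneg.2 hlam.le)]
  rw [← Finset.card_image_of_injective B hinj]
  refine Besicovitch.card_le_of_separated _ ?_ ?_
  · simp only [Finset.forall_mem_image]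
    intro x hx
    rcases eq_or_ne x b with rfl | hne
    · simp
    · rw [hnorm, hpair hx hb hne, inv_mul_cancel₀ hlam.ne']
      norm_num
  · simp only [Finset.forall_mem_image]
    intro x hx y hy hne
    have hxy : x ≠ y := fun h => hne (by rw [h])
    rw [← smul_sub, sub_sub_sub_cancel_right, hnorm, hpair hx hy hxy, inv_mul_cancel₀ hlam.ne']

/-- The entries of the Sylvester-Hadamard matrix with rows and columns indexed by subsets. -/
def walsh {m : ℕ} (S T : Finset (Fin m)) : ℝ := (-1) ^ (S ∩ T).card

theorem walsh_comm {m : ℕ} (S T : Finset (Fin m)) : walsh S T = walsh T S := by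
  rw [walsh, walsh, Finset.inter_comm]

theorem walsh_eq_one_or_neg_one {m : ℕ} (S T : Finset (Fin m)) : walsh S T = 1 ∨ walsh S T = -1 :=
  neg_one_pow_eq_or ℝ _

@[simp]
theorem walsh_empty_right {m : ℕ} (S : Finset (Fin m)) : walsh S ∅ = 1 := by
  simp [walsh]

theorem walsh_eq_prod {m : ℕ} (S T : Finset (Fin m)) :
    walsh S T = ∏ i ∈ S, if i ∈ T then (-1 : ℝ) else 1 := by
  rw [Finset.prod_ite, Finset.prod_const, Finset.prod_const_one, mul_one, Finset.filter_mem_eq_inter,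
    walsh]

theorem sum_walsh_mul_walsh {m : ℕ} (T T' : Finset (Fin m)) :
    ∑ S, walsh S T * walsh S T' = if T = T' then 2 ^ m else 0 := by
  simp only [walsh_eq_prod, ← Finset.prod_mul_distrib]
  rw [← Finset.powerset_univ, ← Finset.prod_one_add]
  split_ifs with h
  · subst h
    have : ∀ i : Fin m, (1 + (if i ∈ T then (-1 : ℝ) else 1) * if i ∈ T then (-1 : ℝ) else 1) = 2 :=
      fun i => by split_ifs <;> norm_num
    simp only [this, Finset.prod_const, Finset.card_univ, Fintype.card_fin]
  · obtain ⟨i, hi⟩ : ∃ i, ¬(i ∈ T ↔ i ∈ T') := by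
      by_contra! hall
      exact h (Finset.ext hall)
    refine Finset.prod_eq_zero (Finset.mem_univ i) ?_
    by_cases h1 : i ∈ T <;> by_cases h2 : i ∈ T' <;> simp_all

theorem sum_nonempty_eq_sum_sub {m : ℕ} (f : Finset (Fin m) → ℝ) :
    ∑ T : {T : Finset (Fin m) // T ≠ ∅}, f T = ∑ T, f T - f ∅ := by
  rw [← Finset.sum_subtype (Finset.univ.erase ∅) (by simp) f,
    ← Finset.sum_erase_add Finset.univ f (Finset.mem_univ ∅), add_sub_cancel_right]

theorem sum_abs_walsh_sub_walsh_rpow {m : ℕ} {p : ℝ} (hp : p ≠ 0) {S S' : Finset (Fin m)}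
    (h : S ≠ S') :
    ∑ T : {T : Finset (Fin m) // T ≠ ∅}, |walsh S T - walsh S' T| ^ p = 2 ^ m * 2 ^ (p - 1) := by
  have hterm : ∀ T, |walsh S T - walsh S' T| ^ p = 2 ^ (p - 1) * (1 - walsh T S * walsh T S') := by
    intro T
    rw [walsh_comm T S, walsh_comm T S', Real.rpow_sub_one two_ne_zero]
    rcases walsh_eq_one_or_neg_one S T with h1 | h1 <;>
      rcases walsh_eq_one_or_neg_one S' T with h2 | h2 <;> rw [h1, h2] <;>
      norm_num [Real.zero_rpow hp]
  rw [sum_nonempty_eq_sum_sub fun T => |walsh S T - walsh S' T| ^ p]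
  simp only [hterm, ← Finset.mul_sum, Finset.sum_sub_distrib, sum_walsh_mul_walsh, if_neg h]
  simp [walsh_comm ∅]
  ring

/-- The origin is the only point equidistant from all rows of the Sylvester-Hadamard matrix
with its constant column removed. -/
theorem eq_zero_of_sum_abs_sub_walsh_rpow_eq {m : ℕ} {p κ : ℝ} (hp : 0 < p)
    {y : {T : Finset (Fin m) // T ≠ ∅} → ℝ}
    (hy : ∀ S : Finset (Fin m), ∑ T, |y T - walsh S T| ^ p = κ) : y = 0 := by
  funext T₀
  let a : {T : Finset (Fin m) // T ≠ ∅} → ℝ := fun T => (|y T - 1| ^ p + |y T + 1| ^ p) / 2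
  let b : {T : Finset (Fin m) // T ≠ ∅} → ℝ := fun T => (|y T + 1| ^ p - |y T - 1| ^ p) / 2
  have hab : ∀ (S : Finset (Fin m)) (T : {T : Finset (Fin m) // T ≠ ∅}),
      |y T - walsh S T| ^ p = a T - walsh S T * b T := by
    intro S T
    rcases walsh_eq_one_or_neg_one S T with h | h <;> simp only [h, a, b, sub_neg_eq_add] <;> ring
  have hbal : ∑ S, walsh S (T₀ : Finset (Fin m)) = 0 := by
    simpa [T₀.2] using sum_walsh_mul_walsh (T₀ : Finset (Fin m)) ∅
  have h0 : ∑ S : Finset (Fin m), walsh S T₀ * ∑ T, |y T - walsh S T| ^ p = 0 := by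
    simp only [hy, ← Finset.sum_mul, hbal, zero_mul]
  have hb : ∑ S : Finset (Fin m), walsh S T₀ * ∑ T, |y T - walsh S T| ^ p = -(2 ^ m * b T₀) := by
    have : ∀ S : Finset (Fin m), walsh S T₀ * ∑ T, |y T - walsh S T| ^ p =
        walsh S T₀ * ∑ T, a T -
          ∑ T : {T : Finset (Fin m) // T ≠ ∅}, walsh S T₀ * walsh S T * b T := fun S => by
      simp only [hab, Finset.sum_sub_distrib, mul_sub, Finset.mul_sum, mul_assoc]
    simp only [this, Finset.sum_sub_distrib, ← Finset.sum_mul, hbal, zero_mul]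
    rw [Finset.sum_comm]
    simp only [← Finset.sum_mul, sum_walsh_mul_walsh, Subtype.coe_inj, ite_mul, zero_mul,
      Finset.sum_ite_eq, Finset.mem_univ, if_true, zero_sub]
  have hb0 : b T₀ = 0 := by
    have : (2 : ℝ) ^ m * b T₀ = 0 := by linarith
    exact (mul_eq_zero.1 this).resolve_left (by positivity)
  have habs : |y T₀ + 1| = |y T₀ - 1| := by
    refine (Real.rpow_left_inj (abs_nonneg _) (abs_nonneg _) hp.ne').1 ?_
    have : (|y T₀ + 1| ^ p - |y T₀ - 1| ^ p) / 2 = 0 := hb0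
    linarith
  rcases abs_eq_abs.1 habs with h | h
  · linarith
  · simp only [Pi.zero_apply]; linarith

section lp

open scoped ENNReal

variable {Γ J : Type*} [Fintype J] {q : ℝ≥0∞}

theorem sum_sum_norm_sub_rpow_le [Fact (1 ≤ q)] (hq0 : 0 < q.toReal) (hq2 : q.toReal < 2)
    {ι : Type*} (s : Finset ι) (x : ι → lp (fun _ : Γ => ℝ) q) :
    ∑ i ∈ s, ∑ j ∈ s, ‖x i - x j‖ ^ q.toReal ≤ 2 * s.card * ∑ i ∈ s, ‖x i‖ ^ q.toReal := by
  refine hasSum_le (fun γ => ?_)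
    (hasSum_sum fun i _ => hasSum_sum fun j _ => lp.hasSum_norm hq0 (x i - x j))
    ((hasSum_sum fun i _ => lp.hasSum_norm hq0 (x i)).mul_left _)
  simpa using sum_sum_abs_sub_rpow_le hq0 hq2 s fun i => x i γ

/-- A finitely supported element of `ℓ_q(Γ)` with prescribed values along an embedding. -/
noncomputable def lpExtend (q : ℝ≥0∞) (e : J ↪ Γ) (v : J → ℝ) : lp (fun _ : Γ => ℝ) q :=
  ⟨Function.extend e v 0, (memℓp_zero ((Set.finite_range e).subset fun γ hγ => by
    by_contra h
    exact hγ (Function.extend_apply' _ _ _ h))).of_exponent_ge zero_le⟩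

theorem lpExtend_apply (e : J ↪ Γ) (v : J → ℝ) (j : J) : lpExtend q e v (e j) = v j :=
  e.injective.extend_apply _ _ _

theorem lpExtend_apply_of_notMem {e : J ↪ Γ} {v : J → ℝ} {γ : Γ} (h : γ ∉ Set.range e) :
    lpExtend q e v γ = 0 :=
  Function.extend_apply' _ _ _ h

theorem norm_sub_lpExtend_rpow [Fact (1 ≤ q)] (hq0 : 0 < q.toReal) (e : J ↪ Γ) (v : J → ℝ)
    (x : lp (fun _ : Γ => ℝ) q) :
    ‖x - lpExtend q e v‖ ^ q.toReal =
      ‖x‖ ^ q.toReal + ∑ j, (|x (e j) - v j| ^ q.toReal - |x (e j)| ^ q.toReal) := by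
  have h1 := (lp.hasSum_norm hq0 (x - lpExtend q e v)).sub (lp.hasSum_norm hq0 x)
  have h2 : HasSum (fun γ => ‖(x - lpExtend q e v) γ‖ ^ q.toReal - ‖x γ‖ ^ q.toReal)
      (∑ j, (|x (e j) - v j| ^ q.toReal - |x (e j)| ^ q.toReal)) := by
    rw [← e.injective.hasSum_iff fun γ hγ => ?_]
    · simpa [Function.comp_def, lpExtend_apply] using
        hasSum_fintype fun j => |x (e j) - v j| ^ q.toReal - |x (e j)| ^ q.toReal
    · simp [lpExtend_apply_of_notMem hγ]
  linarith [h1.unique h2]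

theorem norm_lpExtend_sub_lpExtend_rpow [Fact (1 ≤ q)] (hq0 : 0 < q.toReal) (e : J ↪ Γ)
    (u v : J → ℝ) :
    ‖lpExtend q e u - lpExtend q e v‖ ^ q.toReal = ∑ j, |u j - v j| ^ q.toReal := by
  have h := norm_sub_lpExtend_rpow hq0 e u 0
  simp only [zero_sub, norm_neg, lp.coeFn_zero, Pi.zero_apply, abs_neg, abs_zero, norm_zero,
    Real.zero_rpow hq0.ne', sub_zero, zero_add] at h
  rw [norm_sub_lpExtend_rpow hq0]
  simp [lpExtend_apply, h]

/-- The rows of the Sylvester-Hadamard matrix without its constant column, placed in `ℓ_q(Γ)`. -/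
noncomputable def walshPoint {m : ℕ} (q : ℝ≥0∞) (e : {T : Finset (Fin m) // T ≠ ∅} ↪ Γ)
    (S : Finset (Fin m)) : lp (fun _ : Γ => ℝ) q :=
  lpExtend q e fun T => walsh S T

variable {m : ℕ} {e : {T : Finset (Fin m) // T ≠ ∅} ↪ Γ}

theorem norm_walshPoint_sub_walshPoint_rpow [Fact (1 ≤ q)] (hq0 : 0 < q.toReal)
    {S S' : Finset (Fin m)} (h : S ≠ S') :
    ‖walshPoint q e S - walshPoint q e S'‖ ^ q.toReal = 2 ^ m * 2 ^ (q.toReal - 1) := by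
  rw [walshPoint, walshPoint, norm_lpExtend_sub_lpExtend_rpow hq0,
    sum_abs_walsh_sub_walsh_rpow hq0.ne' h]

theorem norm_rpow_of_forall_norm_sub_walshPoint [Fact (1 ≤ q)] (hq0 : 0 < q.toReal) {κ : ℝ}
    {x : lp (fun _ : Γ => ℝ) q}
    (hx : ∀ S : Finset (Fin m), ‖x - walshPoint q e S‖ ^ q.toReal = κ) :
    ‖x‖ ^ q.toReal = κ - (2 ^ m - 1) := by
  simp only [walshPoint, norm_sub_lpExtend_rpow hq0, Finset.sum_sub_distrib] at hx
  have hy : (fun T => x (e T)) = 0 := eq_zero_of_sum_abs_sub_walsh_rpow_eq hq0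
    (κ := κ - ‖x‖ ^ q.toReal + ∑ T, |x (e T)| ^ q.toReal) fun S => by linarith [hx S]
  have hy' : ∀ T, x (e T) = 0 := congrFun hy
  have habs : ∀ T : Finset (Fin m), |walsh ∅ T| = 1 := fun T => by simp [walsh]
  have h := hx ∅
  simp only [hy', zero_sub, abs_neg, habs, abs_zero, Real.zero_rpow hq0.ne', Real.one_rpow,
    Finset.sum_const_zero, sub_zero] at h
  rw [sum_nonempty_eq_sum_sub fun _ => 1] at h
  simp at h
  linarith

theorem walshPoint_injective [Fact (1 ≤ q)] (hq0 : 0 < q.toReal) :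
    Function.Injective (walshPoint q e) := by
  intro S S' h
  by_contra hne
  have := norm_walshPoint_sub_walshPoint_rpow (e := e) hq0 hne
  rw [h, sub_self, norm_zero, Real.zero_rpow hq0.ne'] at this
  have : (0 : ℝ) < 2 ^ m * 2 ^ (q.toReal - 1) := by positivity
  linarith

theorem equilateral_range_walshPoint [Fact (1 ≤ q)] (hq0 : 0 < q.toReal) :
    Equilateral (Set.range (walshPoint q e)) := by
  refine ⟨(2 ^ m * 2 ^ (q.toReal - 1)) ^ q.toReal⁻¹, by positivity, ?_⟩
  rintro _ ⟨S, rfl⟩ _ ⟨S', rfl⟩ hne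
  rw [← norm_walshPoint_sub_walshPoint_rpow (e := e) hq0 fun h : S = S' => hne (by rw [h]),
    Real.rpow_rpow_inv (norm_nonneg _) hq0.ne']

theorem card_mul_le_of_norm_rpow_eq [Fact (1 ≤ q)] (hq0 : 0 < q.toReal) (hq2 : q.toReal < 2)
    {D : Finset (lp (fun _ : Γ => ℝ) q)} {κ σ : ℝ} (hκ : 0 ≤ κ)
    (hnorm : ∀ x ∈ D, ‖x‖ ^ q.toReal = σ)
    (hdist : ∀ x ∈ D, ∀ y ∈ D, x ≠ y → ‖x - y‖ ^ q.toReal = κ) :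
    D.card * (κ - 2 * σ) ≤ κ := by
  classical
  have h := sum_sum_norm_sub_rpow_le hq0 hq2 D fun x => x
  have hinner : ∀ x ∈ D, ∑ y ∈ D, ‖x - y‖ ^ q.toReal = D.card * κ - κ := fun x hx => by
    have : ∀ y ∈ D, ‖x - y‖ ^ q.toReal = κ - if x = y then κ else 0 := fun y hy => by
      split_ifs with hxy
      · simp [hxy, Real.zero_rpow hq0.ne']
      · simpa using hdist x hx y hy hxy
    rw [Finset.sum_congr rfl this]
    simp [hx]
  rw [Finset.sum_congr rfl hinner, Finset.sum_congr rfl (g := fun _ => σ) hnorm] at h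
  simp only [Finset.sum_const, nsmul_eq_mul] at h
  rcases D.eq_empty_or_nonempty with rfl | hD
  · simpa using hκ
  · have hpos : (0 : ℝ) < D.card := by exact_mod_cast hD.card_pos
    nlinarith [le_of_mul_le_mul_left (show (D.card : ℝ) * (D.card * κ - κ) ≤
      D.card * (2 * (D.card * σ)) by linarith) hpos]

theorem card_mul_le_of_walshPoint_mem [Fact (1 ≤ q)] (hq0 : 0 < q.toReal) (hq2 : q.toReal < 2)
    (hm : m ≠ 0) {B : Finset (lp (fun _ : Γ => ℝ) q)}
    (hB : Equilateral (B : Set (lp (fun _ : Γ => ℝ) q))) (hAB : ∀ S, walshPoint q e S ∈ B) :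
    ((B.card : ℝ) - 2 ^ m) * (2 * (2 ^ m - 1) - 2 ^ m * 2 ^ (q.toReal - 1)) ≤
      2 ^ m * 2 ^ (q.toReal - 1) := by
  classical
  obtain ⟨lam, hlam, hpair⟩ := hB
  set κ : ℝ := 2 ^ m * 2 ^ (q.toReal - 1) with hκ
  have hlamκ : lam ^ q.toReal = κ := by
    have : NeZero m := ⟨hm⟩
    have hne : (∅ : Finset (Fin m)) ≠ {0} := (Finset.singleton_ne_empty _).symm
    rw [← hpair (hAB ∅) (hAB {0}) fun h => hne (walshPoint_injective hq0 h),
      norm_walshPoint_sub_walshPoint_rpow hq0 hne]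
  have hdist : ∀ x ∈ B, ∀ y ∈ B, x ≠ y → ‖x - y‖ ^ q.toReal = κ := fun x hx y hy hne => by
    rw [hpair hx hy hne, hlamκ]
  let A : Finset (lp (fun _ : Γ => ℝ) q) := Finset.univ.image (walshPoint q e)
  have hA : A.card = 2 ^ m := by
    rw [Finset.card_image_of_injective _ (walshPoint_injective hq0)]
    simp
  have hsub : A ⊆ B := Finset.image_subset_iff.2 fun S _ => hAB S
  have hcard : ((B \ A).card : ℝ) = B.card - 2 ^ m := by
    rw [Finset.cast_card_sdiff hsub, hA]
    norm_num
  have h := card_mul_le_of_norm_rpow_eq hq0 hq2 (D := B \ A) (κ := κ) (σ := κ - (2 ^ m - 1))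
    (by positivity)
    (fun x hx => by
      rw [Finset.mem_sdiff] at hx
      refine norm_rpow_of_forall_norm_sub_walshPoint (e := e) hq0 fun S =>
        hdist x hx.1 _ (hAB S) fun h => hx.2 ?_
      rw [h]
      exact Finset.mem_image_of_mem _ (Finset.mem_univ S))
    (fun x hx y hy => hdist x (Finset.mem_sdiff.1 hx).1 y (Finset.mem_sdiff.1 hy).1)
  rw [hcard] at h
  linarith

theorem Equilateral.card_le_five_pow_card [Fact (1 ≤ q)] {Γ : Type*} [Fintype Γ]
    {B : Finset (lp (fun _ : Γ => ℝ) q)} (hB : Equilateral (B : Set (lp (fun _ : Γ => ℝ) q))) :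
    B.card ≤ 5 ^ Fintype.card Γ := by
  let f : lp (fun _ : Γ => ℝ) q →ₗ[ℝ] Γ → ℝ :=
    { toFun := fun x => x
      map_add' := fun _ _ => rfl
      map_smul' := fun _ _ => rfl }
  have hf : Function.Injective f := fun _ _ h => lp.ext h
  have := FiniteDimensional.of_injective f hf
  refine hB.card_le_five_pow_finrank.trans (Nat.pow_le_pow_right (by norm_num) ?_)
  simpa using LinearMap.finrank_le_finrank_of_injective hf

end lp

theorem nonempty_embedding_or_card_le (α β : Type*) [Fintype α] :
    Nonempty (α ↪ β) ∨ ∃ _ : Fintype β, Fintype.card β ≤ Fintype.card α := by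
  rcases fintypeOrInfinite β with hβ | hβ
  · rcases le_total (Fintype.card α) (Fintype.card β) with h | h
    · exact Or.inl (Function.Embedding.nonempty_of_card_le h)
    · exact Or.inr ⟨hβ, h⟩
  · exact Or.inl ⟨(Fintype.equivFin α).toEmbedding.trans
      (Fin.valEmbedding.trans (Infinite.natEmbedding β))⟩

/-- For each `p ∈ [1,2)` there is a constant `C = C(p) ∈ ℕ` such that
for every set (type) `Γ`, the space `ℓ_p(Γ)` contains a maximal equilateral set of
cardinality at most `C`; that is, `m(ℓ_p(Γ)) ≤ C` with `C` independent of `Γ`. -/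
theorem statement18 (p : ℝ) (hp1 : 1 ≤ p) (hp2 : p < 2) :
    ∃ C : ℕ, ∀ Γ : Type,
      letI : Fact (1 ≤ ENNReal.ofReal p) := ⟨ENNReal.one_le_ofReal.mpr hp1⟩
      ∃ A : Set (lp (fun _ : Γ => ℝ) (ENNReal.ofReal p)),
        MaximalEquilateral A ∧ A.Finite ∧ A.ncard ≤ C := by
  have hgap : 0 < 2 - (2 : ℝ) ^ (p - 1) := by
    have := Real.rpow_lt_rpow_of_exponent_lt one_lt_two (show p - 1 < 1 by linarith)
    rw [Real.rpow_one] at this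
    linarith
  obtain ⟨m, hm⟩ := pow_unbounded_of_one_lt (2 / (2 - (2 : ℝ) ^ (p - 1))) one_lt_two
  rw [div_lt_iff₀ hgap] at hm
  have hm0 : m ≠ 0 := by
    rintro rfl
    have := Real.one_le_rpow one_le_two (show 0 ≤ p - 1 by linarith)
    linarith
  set κ : ℝ := 2 ^ m * 2 ^ (p - 1) with hκ
  have hδ : 0 < 2 * (2 ^ m - 1) - κ := by linarith
  refine ⟨max (5 ^ Fintype.card {T : Finset (Fin m) // T ≠ ∅})
    ⌊2 ^ m + κ / (2 * (2 ^ m - 1) - κ)⌋₊, fun Γ => ?_⟩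
  have : Fact (1 ≤ ENNReal.ofReal p) := ⟨ENNReal.one_le_ofReal.mpr hp1⟩
  have hp : (ENNReal.ofReal p).toReal = p := ENNReal.toReal_ofReal (by linarith)
  have hq0 : 0 < (ENNReal.ofReal p).toReal := by linarith
  have hq2 : (ENNReal.ofReal p).toReal < 2 := by linarith
  rcases nonempty_embedding_or_card_le {T : Finset (Fin m) // T ≠ ∅} Γ with ⟨⟨e⟩⟩ | ⟨_, hΓ⟩
  · classical
    refine exists_maximalEquilateral_of_card_le
      (A := Finset.univ.image (walshPoint (ENNReal.ofReal p) e)) ?_ fun B hAB hB => ?_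
    · simpa using equilateral_range_walshPoint hq0
    · refine le_max_of_le_right (Nat.le_floor ?_)
      have h := card_mul_le_of_walshPoint_mem hq0 hq2 hm0 hB
        fun S => hAB (Finset.mem_image_of_mem _ (Finset.mem_univ S))
      rw [hp, ← hκ, ← le_div_iff₀ hδ] at h
      linarith
  · refine exists_maximalEquilateral_of_card_le (A := ∅) ⟨1, one_pos, by simp⟩ fun B _ hB => ?_
    exact le_max_of_le_left
      (hB.card_le_five_pow_card.trans (Nat.pow_le_pow_right (by norm_num) hΓ))
end
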